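/- Let A be a unital C*-algebra with the Dixmier property and let a, b ∈ A. Let Y be the set of maximal closed two-sided ideals M of A such that A has a (necessarily unique) tracial state τ_M vanishing on M, and for each maximal ideal M define F_a(M) := {τ_M(a)} if M ∈ Y and F_a(M) := W_{A/M}(q_M(a)) otherwise, and likewise F_b(M). Set r := sup over maximal ideals M of d(F_a(M), F_b(M)). Then the distance between D_A(a) and D_A(b) equals r; moreover, if a and b are both self-adjoint, or if b = 0, then this distance is attained by elements of D_A(a) ∩ Z(A) and D_A(b) ∩ Z(A). -/

import Mathlib

open scoped ComplexOrder Classical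

noncomputable section

variable {A : Type*} [CStarAlgebra A]

/-- The distance between two subsets of a (pseudo)metric space:
`d(D₁, D₂) = inf {dist x y : x ∈ D₁, y ∈ D₂}`. -/
def setDist {E : Type*} [PseudoMetricSpace E] (s t : Set E) : ℝ :=
  sInf {r : ℝ | ∃ x ∈ s, ∃ y ∈ t, r = dist x y}

/-- A tracial state on a C*-algebra: a positive linear functional of norm 1 with the trace
property. -/
def IsTracialState (τ : A →L[ℂ] ℂ) : Prop :=
  ‖τ‖ = 1 ∧ (∀ a : A, 0 ≤ τ (star a * a)) ∧ ∀ a b : A, τ (a * b) = τ (b * a)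

/-- A state on a C*-algebra: a positive linear functional of norm 1. -/
def IsState (ρ : A →L[ℂ] ℂ) : Prop :=
  ‖ρ‖ = 1 ∧ ∀ a : A, 0 ≤ ρ (star a * a)

/-- A closed two-sided ideal of a C*-algebra, regarded as a `ℂ`-submodule. -/
def IsClosedTwoSidedIdeal (I : Submodule ℂ A) : Prop :=
  IsClosed (I : Set A) ∧ ∀ a b : A, b ∈ I → a * b ∈ I ∧ b * a ∈ I

/-- A maximal (proper, closed, two-sided) ideal of a C*-algebra. -/
def IsMaximalClosedIdeal (M : Submodule ℂ A) : Prop :=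
  IsClosedTwoSidedIdeal M ∧ M ≠ ⊤ ∧
    ∀ J : Submodule ℂ A, IsClosedTwoSidedIdeal J → J ≠ ⊤ → M ≤ J → J = M

/-- The Dixmier set of `a`: the norm-closed convex hull of the unitary conjugates of `a`. -/
def dixmierSet (a : A) : Set A :=
  closure (convexHull ℝ {b : A | ∃ u : unitary A, b = (u : A) * a * star (u : A)})

/-- The Dixmier property. -/
def DixmierProperty (A : Type*) [CStarAlgebra A] : Prop :=
  ∀ a : A, (dixmierSet a ∩ Set.center A).Nonempty

/-- The algebraic numerical range `W_{A/M}(q_M(a))` of the image of `a` in the quotient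
`A/M`, identified with the set of values `ρ(a)` over states `ρ` of `A` vanishing on `M`. -/
def quotNumericalRange (M : Submodule ℂ A) (a : A) : Set ℂ :=
  {c : ℂ | ∃ ρ : A →L[ℂ] ℂ, IsState ρ ∧ (∀ x ∈ M, ρ x = 0) ∧ c = ρ a}

/-- The set `F_a(M)`: the singleton `{τ_M(a)}` if `M` lies in `Y`, i.e. `A` admits a
(necessarily unique, given the Dixmier property) tracial state `τ_M` vanishing on `M`; and
the numerical range `W_{A/M}(q_M(a))` otherwise. -/
def dixmierF (M : Submodule ℂ A) (a : A) : Set ℂ :=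
  if (∃ τ : A →L[ℂ] ℂ, IsTracialState τ ∧ ∀ x ∈ M, τ x = 0) then
    {c : ℂ | ∃ τ : A →L[ℂ] ℂ, IsTracialState τ ∧ (∀ x ∈ M, τ x = 0) ∧ c = τ a}
  else quotNumericalRange M a

/-- The map `c ↦ x * c * star x`. -/
def conjL (x : A) : A →L[ℂ] A :=
  (ContinuousLinearMap.mul ℂ A x).comp ((ContinuousLinearMap.mul ℂ A).flip (star x))

@[simp] lemma conjL_apply (x c : A) : conjL x c = x * c * star x := by
  simp [conjL, mul_assoc]

lemma conjL_mul (x y : A) : conjL (x * y) = (conjL x).comp (conjL y) := by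
  ext c; simp [mul_assoc]

/-- The convex hull of the inner maps `conjL u`, for `u` in a monoid `P`. -/
def avgMaps (P : Submonoid A) : Set (A →L[ℂ] A) := convexHull ℝ (conjL '' (P : Set A))

/-- The closed convex hull of the conjugates of `a` by elements of `P`. -/
def dixSet (P : Submonoid A) (a : A) : Set A := closure ((fun T : A →L[ℂ] A => T a) '' avgMaps P)

lemma conjL_mem_avgMaps {P : Submonoid A} {u : A} (hu : u ∈ P) : conjL u ∈ avgMaps P :=
  subset_convexHull ℝ _ ⟨u, hu, rfl⟩

lemma convex_avgMaps (P : Submonoid A) : Convex ℝ (avgMaps P) := convex_convexHull ℝ _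

lemma avgMaps_mono {P Q : Submonoid A} (h : P ≤ Q) : avgMaps P ⊆ avgMaps Q :=
  convexHull_mono (Set.image_mono h)

lemma one_mem_avgMaps (P : Submonoid A) : ContinuousLinearMap.id ℂ A ∈ avgMaps P := by
  have : conjL (1 : A) = ContinuousLinearMap.id ℂ A := by ext c; simp
  exact this ▸ conjL_mem_avgMaps P.one_mem

/-- Induction for averaging maps. -/
lemma avgMaps_induction {P : Submonoid A} {p : (A →L[ℂ] A) → Prop}
    (hconj : ∀ u ∈ P, p (conjL u))
    (hconv : ∀ S T : A →L[ℂ] A, p S → p T → ∀ s t : ℝ, 0 ≤ s → 0 ≤ t → s + t = 1 →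
      p (s • S + t • T)) {T : A →L[ℂ] A} (hT : T ∈ avgMaps P) : p T := by
  have hc : Convex ℝ {T | p T} := fun S hS T hT s t hs ht hst => hconv S T hS hT s t hs ht hst
  refine convexHull_min ?_ hc hT
  rintro _ ⟨u, hu, rfl⟩
  exact hconj u hu

lemma comp_mem_avgMaps {P : Submonoid A} {S T : A →L[ℂ] A} (hS : S ∈ avgMaps P)
    (hT : T ∈ avgMaps P) : S.comp T ∈ avgMaps P := by
  refine avgMaps_induction (p := fun S => S.comp T ∈ avgMaps P) ?_ ?_ hS
  · intro u hu
    refine avgMaps_induction (p := fun T => (conjL u).comp T ∈ avgMaps P) ?_ ?_ hT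
    · intro v hv
      rw [← conjL_mul]
      exact conjL_mem_avgMaps (P.mul_mem hu hv)
    · intro S T hS hT s t hs ht hst
      have : (conjL u).comp (s • S + t • T) = s • (conjL u).comp S + t • (conjL u).comp T := by
        ext c; simp
      rw [this]
      exact convex_avgMaps P hS hT hs ht hst
  · intro S S' hS hS' s t hs ht hst
    have : (s • S + t • S').comp T = s • S.comp T + t • S'.comp T := by
      ext c; simp
    rw [this]
    exact convex_avgMaps P hS hS' hs ht hst

lemma norm_avgMaps_apply_le {P : Submonoid A} (hP : P ≤ unitary A) {T : A →L[ℂ] A}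
    (hT : T ∈ avgMaps P) (c : A) : ‖T c‖ ≤ ‖c‖ := by
  refine avgMaps_induction (p := fun T => ‖T c‖ ≤ ‖c‖) ?_ ?_ hT
  · intro u hu
    have hu' := hP hu
    rw [conjL_apply, mul_assoc, CStarRing.norm_mem_unitary_mul _ hu',
      CStarRing.norm_mul_mem_unitary _ (Unitary.star_mem hu')]
  · intro S T hS hT s t hs ht hst
    calc ‖(s • S + t • T) c‖ ≤ ‖s • S c‖ + ‖t • T c‖ := by
          simpa using norm_add_le (s • S c) (t • T c)
      _ = s * ‖S c‖ + t * ‖T c‖ := by simp [norm_smul, abs_of_nonneg hs, abs_of_nonneg ht]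
      _ ≤ s * ‖c‖ + t * ‖c‖ := by gcongr
      _ = ‖c‖ := by rw [← add_mul, hst, one_mul]

lemma avgMaps_apply_central {P : Submonoid A} (hP : P ≤ unitary A) {T : A →L[ℂ] A}
    (hT : T ∈ avgMaps P) {z : A} (hz : z ∈ Set.center A) : T z = z := by
  refine avgMaps_induction (p := fun T => T z = z) ?_ ?_ hT
  · intro u hu
    have hu' := hP hu
    rw [conjL_apply, ← (Set.mem_center_iff.1 hz).comm u, mul_assoc,
      Unitary.mul_star_self_of_mem hu', mul_one]
  · intro S T hS hT s t hs ht hst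
    simp [hS, hT, ← add_smul, hst]

lemma avgMaps_apply_star {P : Submonoid A} {T : A →L[ℂ] A}
    (hT : T ∈ avgMaps P) (c : A) : T (star c) = star (T c) := by
  refine avgMaps_induction (p := fun T => T (star c) = star (T c)) ?_ ?_ hT
  · intro u hu
    simp [mul_assoc]
  · intro S T hS hT s t hs ht hst
    simp [hS, hT, star_smul]

lemma avgMaps_apply_mem {P : Submonoid A} {T : A →L[ℂ] A} (hT : T ∈ avgMaps P)
    {M : Submodule ℂ A} (hM : ∀ a b : A, b ∈ M → a * b ∈ M ∧ b * a ∈ M) {c : A} (hc : c ∈ M) :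
    T c ∈ M := by
  refine avgMaps_induction (p := fun T => T c ∈ M) ?_ ?_ hT
  · intro u hu
    rw [conjL_apply]
    exact (hM _ _ (hM _ _ hc).1).2
  · intro S T hS hT s t hs ht hst
    exact M.add_mem (M.smul_mem (s : ℂ) hS) (M.smul_mem (t : ℂ) hT)

lemma avgMaps_apply_nonneg [PartialOrder A] [StarOrderedRing A] {P : Submonoid A}
    {T : A →L[ℂ] A} (hT : T ∈ avgMaps P) {c : A} (hc : 0 ≤ c) : 0 ≤ T c := by
  refine avgMaps_induction (p := fun T => 0 ≤ T c) ?_ ?_ hT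
  · intro u hu
    rw [conjL_apply]
    exact star_right_conjugate_nonneg hc u
  · intro S T hS hT s t hs ht hst
    simpa using add_nonneg (smul_nonneg hs hS) (smul_nonneg ht hT)

lemma mem_dixSet_iff {P : Submonoid A} {a c : A} :
    c ∈ dixSet P a ↔ ∀ ε > 0, ∃ T ∈ avgMaps P, ‖T a - c‖ < ε := by
  rw [dixSet, Metric.mem_closure_iff]
  simp only [Set.exists_mem_image, dist_eq_norm]
  simp only [norm_sub_rev]

lemma apply_mem_dixSet {P : Submonoid A} {T : A →L[ℂ] A} (hT : T ∈ avgMaps P) (a : A) :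
    T a ∈ dixSet P a := subset_closure ⟨T, hT, rfl⟩

lemma isClosed_dixSet (P : Submonoid A) (a : A) : IsClosed (dixSet P a) := isClosed_closure

lemma dixSet_mono {P Q : Submonoid A} (h : P ≤ Q) (a : A) : dixSet P a ⊆ dixSet Q a :=
  closure_mono (Set.image_mono (avgMaps_mono h))

lemma convex_dixSet (P : Submonoid A) (a : A) : Convex ℝ (dixSet P a) := by
  refine Convex.closure ?_
  rintro _ ⟨S, hS, rfl⟩ _ ⟨T, hT, rfl⟩ s t hs ht hst
  exact ⟨_, convex_avgMaps P hS hT hs ht hst, by simp⟩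

lemma dixSet_subset_of_mem {P : Submonoid A} (hP : P ≤ unitary A) {a c : A}
    (hc : c ∈ dixSet P a) : dixSet P c ⊆ dixSet P a := by
  intro d hd
  rw [mem_dixSet_iff] at *
  intro ε hε
  obtain ⟨S, hS, h1⟩ := hc (ε / 2) (by positivity)
  obtain ⟨T, hT, h2⟩ := hd (ε / 2) (by positivity)
  refine ⟨T.comp S, comp_mem_avgMaps hT hS, ?_⟩
  have h3 := norm_avgMaps_apply_le hP hT (S a - c)
  have : T.comp S a - d = T (S a - c) + (T c - d) := by simp
  rw [this]
  linarith [norm_add_le (T (S a - c)) (T c - d)]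

lemma dixmierSet_eq_dixSet (a : A) : dixmierSet a = dixSet (unitary A) a := by
  unfold dixmierSet dixSet avgMaps
  congr 1
  let ev : (A →L[ℂ] A) →ₗ[ℝ] A :=
    { toFun := fun T => T a, map_add' := fun _ _ => rfl, map_smul' := fun _ _ => rfl }
  have h := ev.image_convexHull (conjL '' ((unitary A : Submonoid A) : Set A))
  change _ = ev '' _
  rw [h]
  congr 1
  ext b
  constructor
  · rintro ⟨u, rfl⟩
    exact ⟨_, ⟨u, u.2, rfl⟩, by simp [ev]⟩
  · rintro ⟨_, ⟨u, hu, rfl⟩, rfl⟩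
    exact ⟨⟨u, hu⟩, by simp [ev]⟩

/-! ### States -/

lemma isSelfAdjoint_le_norm [PartialOrder A] [StarOrderedRing A] {h : A}
    (hh : IsSelfAdjoint h) : h ≤ ((‖h‖ : ℝ) : ℂ) • (1 : A) := by
  have := hh.le_algebraMap_norm_self
  rwa [Algebra.algebraMap_eq_smul_one] at this

lemma positive_apply_nonneg [PartialOrder A] [StarOrderedRing A] {ρ : A →L[ℂ] ℂ}
    (hρ : ∀ a : A, 0 ≤ ρ (star a * a)) {c : A} (hc : 0 ≤ c) : 0 ≤ ρ c := by
  obtain ⟨b, rfl⟩ := CStarAlgebra.nonneg_iff_eq_star_mul_self.1 hc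
  exact hρ b

lemma positive_apply_star [PartialOrder A] [StarOrderedRing A] {ρ : A →L[ℂ] ℂ}
    (hρ : ∀ a : A, 0 ≤ ρ (star a * a)) (a : A) :
    ρ (star a) = star (ρ a) := by
  let f : A →ₚ[ℂ] ℂ := PositiveLinearMap.mk₀ ρ.toLinearMap fun x hx => positive_apply_nonneg hρ hx
  exact map_star f a

lemma re_positive_apply_le [PartialOrder A] [StarOrderedRing A] {ρ : A →L[ℂ] ℂ}
    (hρ : ∀ a : A, 0 ≤ ρ (star a * a)) (a : A) :
    (ρ a).re ≤ (ρ 1).re * ‖a‖ := by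
  have h1 : 0 ≤ (ρ 1).re := by
    have := hρ 1
    rw [star_one, one_mul] at this
    exact (Complex.le_def.1 this).1
  have h2 := positive_apply_nonneg hρ (sub_nonneg.2
    (isSelfAdjoint_le_norm (IsSelfAdjoint.add_star_self a)))
  have h3 := (Complex.le_def.1 h2).1
  simp [positive_apply_star hρ] at h3
  have h4 : ‖a + star a‖ ≤ ‖a‖ + ‖a‖ := by simpa using norm_add_le a (star a)
  nlinarith

lemma norm_apply_le_of_re_le {ρ : A →ₗ[ℂ] ℂ} {C : ℝ} (h : ∀ a, (ρ a).re ≤ C * ‖a‖) (a : A) :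
    ‖ρ a‖ ≤ C * ‖a‖ := by
  by_cases h0 : ρ a = 0
  · have h1 := h a
    rw [h0] at h1 ⊢
    simpa using h1
  have hn : (‖ρ a‖ : ℂ) ≠ 0 := by simpa using h0
  have hc : ‖star (ρ a) / (‖ρ a‖ : ℂ)‖ = 1 := by
    have : ‖ρ a‖ ≠ 0 := by simpa using h0
    simp [this]
  have h2 := h ((star (ρ a) / (‖ρ a‖ : ℂ)) • a)
  rw [norm_smul, hc, one_mul, map_smul, smul_eq_mul, div_mul_eq_mul_div] at h2
  have h3 : star (ρ a) * ρ a / (‖ρ a‖ : ℂ) = ((‖ρ a‖ : ℝ) : ℂ) := by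
    have : star (ρ a) * ρ a = (‖ρ a‖ : ℂ) * (‖ρ a‖ : ℂ) := by
      rw [← sq, ← Complex.conj_mul']; rfl
    rw [this, mul_div_assoc, div_self hn, mul_one]
  rw [h3, Complex.ofReal_re] at h2
  exact h2

lemma isState_iff [PartialOrder A] [StarOrderedRing A] {ρ : A →L[ℂ] ℂ}
    (hρ : ∀ a : A, 0 ≤ ρ (star a * a)) : ‖ρ‖ = 1 ↔ ρ 1 = 1 := by
  have h1 : 0 ≤ ρ 1 := by simpa using hρ 1
  have h2 : ‖ρ‖ = (ρ 1).re := by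
    refine le_antisymm (ρ.opNorm_le_bound (Complex.le_def.1 h1).1 ?_) ?_
    · exact norm_apply_le_of_re_le (ρ := ρ.toLinearMap) (re_positive_apply_le hρ)
    · rcases subsingleton_or_nontrivial A with h | h
      · rw [Subsingleton.elim (1 : A) 0]; simp
      · calc (ρ 1).re ≤ ‖ρ 1‖ := Complex.re_le_norm _
          _ ≤ ‖ρ‖ * ‖(1 : A)‖ := ρ.le_opNorm _
          _ = ‖ρ‖ := by simp
  rw [h2, Complex.ext_iff]
  have h3 := (Complex.le_def.1 h1).2
  simp only [Complex.one_re, Complex.one_im]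
  refine ⟨fun h => ⟨h, h3.symm⟩, fun h => h.1⟩

lemma IsState.map_one [PartialOrder A] [StarOrderedRing A] {ρ : A →L[ℂ] ℂ}
    (hρ : IsState ρ) : ρ 1 = 1 := (isState_iff hρ.2).1 hρ.1

lemma IsState.norm_le {ρ : A →L[ℂ] ℂ} (hρ : IsState ρ) (a : A) : ‖ρ a‖ ≤ ‖a‖ := by
  simpa [hρ.1] using ρ.le_opNorm a

lemma IsTracialState.isState {τ : A →L[ℂ] ℂ} (hτ : IsTracialState τ) : IsState τ := ⟨hτ.1, hτ.2.1⟩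

lemma IsState.comp_avgMaps [PartialOrder A] [StarOrderedRing A] {ρ : A →L[ℂ] ℂ}
    (hρ : IsState ρ) {T : A →L[ℂ] A} (hT : T ∈ avgMaps (unitary A)) : IsState (ρ.comp T) := by
  have h : ∀ a, 0 ≤ (ρ.comp T) (star a * a) := fun a =>
    positive_apply_nonneg hρ.2 (avgMaps_apply_nonneg hT (star_mul_self_nonneg a))
  refine ⟨(isState_iff h).2 ?_, h⟩
  have : T 1 = 1 := avgMaps_apply_central le_rfl hT (Set.one_mem_center)
  simp [this, hρ.map_one]

lemma IsTracialState.apply_avgMaps {τ : A →L[ℂ] ℂ} (hτ : IsTracialState τ) {T : A →L[ℂ] A}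
    (hT : T ∈ avgMaps (unitary A)) (a : A) : τ (T a) = τ a := by
  refine avgMaps_induction (p := fun T => τ (T a) = τ a) ?_ ?_ hT
  · intro u hu
    rw [conjL_apply, hτ.2.2, ← mul_assoc, Unitary.star_mul_self_of_mem hu, one_mul]
  · intro S T hS hT s t hs ht hst
    have : (s • S + t • T) a = (s : ℂ) • S a + (t : ℂ) • T a := by simp
    rw [this, map_add, map_smul, map_smul, hS, hT, ← add_smul, ← Complex.ofReal_add, hst]
    simp

/-! ### The distance between two sets -/

lemma bddBelow_setDist {E : Type*} [PseudoMetricSpace E] (s t : Set E) :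
    BddBelow {r : ℝ | ∃ x ∈ s, ∃ y ∈ t, r = dist x y} :=
  ⟨0, by rintro _ ⟨x, -, y, -, rfl⟩; exact dist_nonneg⟩

lemma setDist_le {E : Type*} [PseudoMetricSpace E] {s t : Set E} {x y : E} (hx : x ∈ s)
    (hy : y ∈ t) : setDist s t ≤ dist x y :=
  csInf_le (bddBelow_setDist s t) ⟨x, hx, y, hy, rfl⟩

lemma setDist_nonneg {E : Type*} [PseudoMetricSpace E] (s t : Set E) : 0 ≤ setDist s t := by
  refine Real.sInf_nonneg ?_
  rintro _ ⟨x, -, y, -, rfl⟩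
  exact dist_nonneg

lemma exists_dist_lt_of_setDist_lt {E : Type*} [PseudoMetricSpace E] {s t : Set E} {r : ℝ}
    (hs : s.Nonempty) (ht : t.Nonempty) (h : setDist s t < r) :
    ∃ x ∈ s, ∃ y ∈ t, dist x y < r := by
  obtain ⟨x, hx⟩ := hs
  obtain ⟨y, hy⟩ := ht
  have hne : {r : ℝ | ∃ x ∈ s, ∃ y ∈ t, r = dist x y}.Nonempty := ⟨_, x, hx, y, hy, rfl⟩
  obtain ⟨_, ⟨x, hx, y, hy, rfl⟩, h⟩ := exists_lt_of_csInf_lt hne h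
  exact ⟨x, hx, y, hy, h⟩

lemma le_setDist {E : Type*} [PseudoMetricSpace E] {s t : Set E} {r : ℝ}
    (hs : s.Nonempty) (ht : t.Nonempty) (h : ∀ x ∈ s, ∀ y ∈ t, r ≤ dist x y) :
    r ≤ setDist s t := by
  obtain ⟨x, hx⟩ := hs
  obtain ⟨y, hy⟩ := ht
  refine le_csInf ⟨_, x, hx, y, hy, rfl⟩ ?_
  rintro _ ⟨x, hx, y, hy, rfl⟩
  exact h x hx y hy

/-! ### The lower bound -/

lemma setDist_dixmierF_le_of_avgMaps [PartialOrder A] [StarOrderedRing A] {M : Submodule ℂ A}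
    (hM : ∀ a b : A, b ∈ M → a * b ∈ M ∧ b * a ∈ M)
    {S T : A →L[ℂ] A} (hS : S ∈ avgMaps (unitary A)) (hT : T ∈ avgMaps (unitary A)) (a b : A) :
    setDist (dixmierF M a) (dixmierF M b) ≤ ‖S a - T b‖ := by
  by_cases hY : ∃ τ : A →L[ℂ] ℂ, IsTracialState τ ∧ ∀ x ∈ M, τ x = 0
  · simp only [dixmierF, if_pos hY]
    obtain ⟨τ, hτ, h0⟩ := hY
    refine le_trans (setDist_le ⟨τ, hτ, h0, rfl⟩ ⟨τ, hτ, h0, rfl⟩) ?_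
    rw [← hτ.apply_avgMaps hS a, ← hτ.apply_avgMaps hT b, dist_eq_norm, ← map_sub]
    exact hτ.isState.norm_le _
  · simp only [dixmierF, if_neg hY]
    by_cases hρ : ∃ ρ : A →L[ℂ] ℂ, IsState ρ ∧ ∀ x ∈ M, ρ x = 0
    · obtain ⟨ρ, hρ, h0⟩ := hρ
      refine le_trans (setDist_le (x := ρ (S a)) (y := ρ (T b))
        ⟨ρ.comp S, hρ.comp_avgMaps hS, fun x hx => h0 _ (avgMaps_apply_mem hS hM hx), rfl⟩
        ⟨ρ.comp T, hρ.comp_avgMaps hT, fun x hx => h0 _ (avgMaps_apply_mem hT hM hx), rfl⟩) ?_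
      rw [dist_eq_norm, ← map_sub]
      exact hρ.norm_le _
    · have : {r : ℝ | ∃ x ∈ quotNumericalRange M a, ∃ y ∈ quotNumericalRange M b, r = dist x y}
          = ∅ := by
        refine Set.eq_empty_of_forall_notMem ?_
        rintro _ ⟨_, ⟨ρ, h1, h2, -⟩, -⟩
        exact hρ ⟨ρ, h1, h2⟩
      simp [setDist, this]

lemma setDist_dixmierF_le [PartialOrder A] [StarOrderedRing A] {M : Submodule ℂ A}
    (hM : ∀ a b : A, b ∈ M → a * b ∈ M ∧ b * a ∈ M) {a b a' b' : A}
    (ha : a' ∈ dixmierSet a) (hb : b' ∈ dixmierSet b) :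
    setDist (dixmierF M a) (dixmierF M b) ≤ ‖a' - b'‖ := by
  rw [dixmierSet_eq_dixSet, mem_dixSet_iff] at ha hb
  refine le_of_forall_pos_le_add fun ε hε => ?_
  obtain ⟨S, hS, h1⟩ := ha (ε / 2) (by positivity)
  obtain ⟨T, hT, h2⟩ := hb (ε / 2) (by positivity)
  refine (setDist_dixmierF_le_of_avgMaps hM hS hT a b).trans ?_
  have : S a - T b = (S a - a') - (T b - b') + (a' - b') := by abel
  rw [this]
  have h3 := norm_add_le ((S a - a') - (T b - b')) (a' - b')
  have h4 := norm_sub_le (S a - a') (T b - b')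
  linarith

lemma self_mem_dixmierSet (a : A) : a ∈ dixmierSet a :=
  subset_closure (subset_convexHull ℝ _ ⟨1, by simp⟩)

lemma sSup_dixmierF_le [PartialOrder A] [StarOrderedRing A] (a b : A) :
    sSup {d : ℝ | ∃ M : Submodule ℂ A, IsMaximalClosedIdeal M ∧
      d = setDist (dixmierF M a) (dixmierF M b)} ≤ setDist (dixmierSet a) (dixmierSet b) := by
  refine Real.sSup_le ?_ (setDist_nonneg _ _)
  rintro _ ⟨M, hM, rfl⟩
  refine le_setDist ⟨a, self_mem_dixmierSet a⟩ ⟨b, self_mem_dixmierSet b⟩ fun x hx y hy => ?_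
  rw [dist_eq_norm]
  exact setDist_dixmierF_le hM.1.2 hx hy

lemma setDist_dixmierF_le_sSup [PartialOrder A] [StarOrderedRing A] {M : Submodule ℂ A}
    (hM : IsMaximalClosedIdeal M) (a b : A) :
    setDist (dixmierF M a) (dixmierF M b) ≤ sSup {d : ℝ | ∃ M : Submodule ℂ A,
      IsMaximalClosedIdeal M ∧ d = setDist (dixmierF M a) (dixmierF M b)} := by
  refine le_csSup ⟨‖a - b‖, ?_⟩ ⟨M, hM, rfl⟩
  rintro _ ⟨N, hN, rfl⟩
  exact setDist_dixmierF_le hN.1.2 (self_mem_dixmierSet a) (self_mem_dixmierSet b)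

/-! ### Gelfand duality for the centre -/

/-- The centre of a C*-algebra, as a star subalgebra. -/
def starCenter (A : Type*) [CStarAlgebra A] : StarSubalgebra ℂ A :=
  { Subalgebra.center ℂ A with star_mem' := fun h => Set.star_mem_center h }

lemma isClosed_center : IsClosed (Set.center A) := by
  have : Set.center A = ⋂ g : A, {z | g * z = z * g} := by
    ext z
    simp [Semigroup.mem_center_iff]
  rw [this]
  exact isClosed_iInter fun g => isClosed_eq (by fun_prop) (by fun_prop)

instance : IsClosed ((starCenter A : StarSubalgebra ℂ A) : Set A) := isClosed_center

instance : CommCStarAlgebra (starCenter A) :=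
  { StarSubalgebra.cstarAlgebra (starCenter A) with
    mul_comm := fun a b => Subtype.ext ((Set.mem_center_iff.1 a.2).comm b) }

lemma exists_center_model.{u} (A : Type u) [CStarAlgebra A] :
    ∃ (X : Type u) (_ : TopologicalSpace X) (_ : CompactSpace X) (ι : C(X, ℂ) →⋆ₐ[ℂ] A),
      Isometry ι ∧ Set.range ι = Set.center A := by
  refine ⟨WeakDual.characterSpace ℂ (starCenter A), inferInstance, inferInstance,
    (starCenter A).subtype.comp
      ((gelfandStarTransform (starCenter A)).symm : _ →⋆ₐ[ℂ] (starCenter A)), ?_, ?_⟩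
  · have h1 : Isometry (gelfandStarTransform (starCenter A)) :=
      gelfandTransform_isometry (starCenter A)
    have h2 : Isometry (gelfandStarTransform (starCenter A)).symm :=
      h1.right_inv (fun x => (gelfandStarTransform (starCenter A)).apply_symm_apply x)
    exact isometry_subtype_coe.comp h2
  · ext z
    constructor
    · rintro ⟨g, rfl⟩
      exact ((gelfandStarTransform (starCenter A)).symm g).2
    · intro hz
      exact ⟨gelfandStarTransform (starCenter A) ⟨z, hz⟩, by simp⟩

/-! ### The monoid generated by exponentials -/

open NormedSpace in
lemma exists_exp_sub_one_eq (z : A) : ∃ b : A, exp z - 1 = z * b := by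
  let _ : NormedAlgebra ℚ A := .restrictScalars ℚ ℂ A
  have h1 := exp_series_hasSum_exp' (𝕂 := ℂ) z
  have h2 : Summable fun n : ℕ => ((n + 1).factorial⁻¹ : ℂ) • z ^ n := by
    refine Summable.of_norm_bounded
      (Real.summable_pow_div_factorial (‖z‖ * 1) |>.mul_left (1 + ‖(1 : A)‖)) fun n => ?_
    have h3 : ‖z ^ n‖ ≤ (1 + ‖(1 : A)‖) * ‖z‖ ^ n := by
      rcases n with _ | n
      · simp
      · have := norm_pow_le' z n.succ_pos
        have h5 := mul_nonneg (norm_nonneg (1 : A)) (pow_nonneg (norm_nonneg z) (n + 1))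
        rw [Nat.succ_eq_add_one] at this
        linarith [add_mul 1 ‖(1 : A)‖ (‖z‖ ^ (n + 1))]
    have h4 : ((n + 1).factorial : ℝ)⁻¹ ≤ ((n.factorial : ℝ))⁻¹ := by
      gcongr; omega
    rw [norm_smul, norm_inv, Complex.norm_natCast, mul_one, ← mul_div_assoc, div_eq_inv_mul]
    gcongr
  refine ⟨∑' n : ℕ, ((n + 1).factorial⁻¹ : ℂ) • z ^ n, ?_⟩
  rw [← h2.tsum_mul_left]
  have h3 := (hasSum_nat_add_iff' 1).2 h1
  simp only [Finset.range_one, Finset.sum_singleton, Nat.factorial_zero, Nat.cast_one, inv_one,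
    pow_zero, one_smul] at h3
  rw [← h3.tsum_eq]
  congr 1
  ext n
  rw [mul_smul_comm, pow_succ']

/-- The monoid generated by the exponentials `exp (i h)` with `h` self-adjoint. -/
def expMonoid (A : Type*) [CStarAlgebra A] : Submonoid A :=
  Submonoid.closure (Set.range fun h : selfAdjoint A => (selfAdjoint.expUnitary h : A))

lemma expUnitary_mem_expMonoid (h : selfAdjoint A) :
    (selfAdjoint.expUnitary h : A) ∈ expMonoid A := Submonoid.subset_closure ⟨h, rfl⟩

lemma expMonoid_le_unitary : expMonoid A ≤ unitary A := by
  refine Submonoid.closure_le.2 ?_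
  rintro _ ⟨h, rfl⟩
  exact (selfAdjoint.expUnitary h).2

lemma conj_mem_expMonoid (u : unitary A) {v : A} (hv : v ∈ expMonoid A) :
    (u : A) * v * star (u : A) ∈ expMonoid A := by
  let _ : NormedAlgebra ℚ A := .restrictScalars ℚ ℂ A
  induction hv using Submonoid.closure_induction with
  | mem v hv =>
    obtain ⟨h, rfl⟩ := hv
    have h1 : IsSelfAdjoint ((u : A) * h * star (u : A)) := h.2.conjugate (u : A)
    have h2 : (u : A) * (selfAdjoint.expUnitary h : A) * star (u : A)
        = selfAdjoint.expUnitary ⟨_, h1⟩ := by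
      have h3 := NormedSpace.exp_units_conj (Unitary.toUnits u) (Complex.I • (h : A))
      simp only [selfAdjoint.expUnitary_coe]
      have h4 : ((Unitary.toUnits u)⁻¹ : Aˣ) = (star (u : A) : A) := rfl
      rw [h4] at h3
      simpa using h3.symm
    rw [h2]
    exact expUnitary_mem_expMonoid _
  | one => simp
  | mul x y _ _ hx hy =>
    have : (u : A) * (x * y) * star (u : A)
        = ((u : A) * x * star (u : A)) * ((u : A) * y * star (u : A)) := by
      have h := Unitary.star_mul_self_of_mem u.2
      calc (u : A) * (x * y) * star (u : A) = (u : A) * x * 1 * y * star (u : A) := by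
            simp only [mul_one, mul_assoc]
        _ = _ := by rw [← h]; simp only [mul_assoc]
    rw [this]
    exact mul_mem hx hy

section Model

variable {X : Type*} [TopologicalSpace X]

/-- The inclusion of the real-valued functions in the complex-valued functions. -/
def toC : C(X, ℝ) →ₐ[ℝ] C(X, ℂ) :=
  AlgHom.compLeftContinuous ℝ Complex.ofRealAm Complex.continuous_ofReal

@[simp] lemma toC_apply (f : C(X, ℝ)) (x : X) : toC f x = (f x : ℂ) := rfl

@[simp] lemma star_toC (f : C(X, ℝ)) : star (toC f) = toC f := by
  ext x; simp

/-- The restriction of a homomorphism from `C(X, ℂ)` to the real-valued functions. -/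
def realEmb (ι : C(X, ℂ) →⋆ₐ[ℂ] A) : C(X, ℝ) →ₐ[ℝ] A :=
  (ι.toAlgHom.restrictScalars ℝ).comp toC

lemma realEmb_apply (ι : C(X, ℂ) →⋆ₐ[ℂ] A) (f : C(X, ℝ)) : realEmb ι f = ι (toC f) := rfl

lemma isSelfAdjoint_realEmb (ι : C(X, ℂ) →⋆ₐ[ℂ] A) (f : C(X, ℝ)) :
    IsSelfAdjoint (realEmb ι f) := by
  rw [IsSelfAdjoint, realEmb_apply, ← map_star, star_toC]

variable {ι : C(X, ℂ) →⋆ₐ[ℂ] A}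

lemma central_comm (hr : Set.range ι = Set.center A) (g : C(X, ℂ)) (a : A) :
    ι g * a = a * ι g := by
  have : ι g ∈ Set.center A := hr ▸ ⟨g, rfl⟩
  exact (Set.mem_center_iff.1 this).comm a

lemma realEmb_comm (hr : Set.range ι = Set.center A) (g : C(X, ℝ)) (a : A) :
    realEmb ι g * a = a * realEmb ι g := central_comm hr _ a

lemma exists_local_expMonoid (hr : Set.range ι = Set.center A) {v : A} (hv : v ∈ expMonoid A)
    (χ : C(X, ℝ)) : ∃ w ∈ expMonoid A, (∃ b, w - 1 = realEmb ι χ * b) ∧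
      ∃ b, w - v = realEmb ι (1 - χ) * b := by
  let _ : NormedAlgebra ℚ A := .restrictScalars ℚ ℂ A
  induction hv using Submonoid.closure_induction with
  | mem v hv =>
    obtain ⟨h, rfl⟩ := hv
    have hs : ∀ f : C(X, ℝ), IsSelfAdjoint (realEmb ι f * h) := fun f =>
      ((isSelfAdjoint_realEmb ι f).commute_iff h.2).1 (realEmb_comm hr f h)
    refine ⟨_, expUnitary_mem_expMonoid ⟨_, hs χ⟩, ?_, ?_⟩
    · obtain ⟨b, hb⟩ := exists_exp_sub_one_eq (Complex.I • (realEmb ι χ * (h : A)))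
      refine ⟨Complex.I • ((h : A) * b), ?_⟩
      rw [selfAdjoint.expUnitary_coe, hb]
      simp [mul_assoc]
    · obtain ⟨b, hb⟩ := exists_exp_sub_one_eq (Complex.I • (realEmb ι (χ - 1) * (h : A)))
      have h1 : (⟨_, hs χ⟩ : selfAdjoint A) = h + ⟨_, hs (χ - 1)⟩ := by
        ext; simp [sub_mul]
      have h2 : Commute (h : A) ((⟨_, hs (χ - 1)⟩ : selfAdjoint A) : A) := by
        change (h : A) * (realEmb ι (χ - 1) * h) = realEmb ι (χ - 1) * h * h
        rw [← mul_assoc, ← realEmb_comm hr]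
      rw [h1, Commute.expUnitary_add h2]
      refine ⟨-(Complex.I • ((selfAdjoint.expUnitary h : A) * (h : A) * b)), ?_⟩
      have h3 : (1 - χ : C(X, ℝ)) = -(χ - 1) := by ring
      have h4 : (((selfAdjoint.expUnitary h * selfAdjoint.expUnitary ⟨_, hs (χ - 1)⟩ :
          unitary A) : A) - selfAdjoint.expUnitary h) =
          (selfAdjoint.expUnitary h : A) *
            (NormedSpace.exp (Complex.I • (realEmb ι (χ - 1) * (h : A))) - 1) := by
        rw [mul_sub, mul_one]; rfl
      rw [h4, hb, h3, map_neg, neg_mul_neg, smul_mul_assoc, mul_smul_comm, mul_smul_comm,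
        ← mul_assoc, ← mul_assoc, ← mul_assoc, ← mul_assoc, ← realEmb_comm hr]
  | one => exact ⟨1, one_mem _, ⟨0, by simp⟩, ⟨0, by simp⟩⟩
  | mul x y _ _ hx hy =>
    obtain ⟨w, hw, ⟨b, hb⟩, c, hc⟩ := hx
    obtain ⟨w', hw', ⟨b', hb'⟩, c', hc'⟩ := hy
    refine ⟨w * w', mul_mem hw hw', ⟨b * w' + b', ?_⟩, c * w' + x * c', ?_⟩
    · rw [mul_add, ← mul_assoc, ← hb, ← hb']; noncomm_ring
    · rw [mul_add, ← mul_assoc, ← mul_assoc, realEmb_comm hr _ x, mul_assoc x, ← hc, ← hc']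
      noncomm_ring

end Model

/-! ### The Dixmier property for the monoid generated by exponentials -/

lemma mem_expMonoid_of_norm_lt {v : A} (hv : v ∈ unitary A) (h : ‖v - 1‖ < 2) :
    v ∈ expMonoid A := by
  have := expUnitary_argSelfAdjoint (u := ⟨v, hv⟩) h
  have h2 := expUnitary_mem_expMonoid (Unitary.argSelfAdjoint ⟨v, hv⟩)
  rwa [this] at h2

lemma add_I_smul_mem_expMonoid [PartialOrder A] [StarOrderedRing A] {s b : A} (hs : 0 ≤ s)
    (hb : IsSelfAdjoint b) (hc : s * b = b * s) (h1 : s * s + b * b = 1) :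
    s + Complex.I • b ∈ expMonoid A := by
  have hs' : IsSelfAdjoint s := .of_nonneg hs
  have hst : star (s + Complex.I • b) = s - Complex.I • b := by
    simp [hs'.star_eq, hb.star_eq, sub_eq_add_neg]
  have hI : Complex.I • Complex.I • (b * b) = -(b * b) := by
    rw [smul_smul, Complex.I_mul_I, neg_one_smul]
  have e1 : (s - Complex.I • b) * (s + Complex.I • b) = 1 := by
    rw [← h1]
    simp only [sub_mul, mul_add, smul_mul_assoc, mul_smul_comm, smul_sub, hc, hI]
    abel
  have e2 : (s + Complex.I • b) * (s - Complex.I • b) = 1 := by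
    rw [← h1]
    simp only [add_mul, mul_sub, smul_mul_assoc, mul_smul_comm, smul_add, hc, hI]
    abel
  refine mem_expMonoid_of_norm_lt ?_ ?_
  · rw [Unitary.mem_iff, hst]
    exact ⟨e1, e2⟩
  · have h2 : star (s + Complex.I • b - 1) * (s + Complex.I • b - 1) = (2 : ℂ) • (1 - s) := by
      rw [star_sub, hst, star_one, sub_mul, mul_sub, e1, two_smul]
      noncomm_ring
    have h3 : s ≤ 1 := by
      have h4 : ‖s * s‖ ≤ 1 := by
        refine (CStarAlgebra.norm_le_one_iff_of_nonneg _ ?_).2 ?_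
        · exact hs'.mul_self_nonneg
        · rw [← h1]; exact le_add_of_nonneg_right hb.mul_self_nonneg
      have h5 : ‖s * s‖ = ‖s‖ * ‖s‖ := by
        conv_lhs => rw [← hs'.star_eq, hs'.star_eq]
        simpa [hs'.star_eq] using CStarRing.norm_star_mul_self (x := s)
      refine (CStarAlgebra.norm_le_one_iff_of_nonneg _ hs).1 ?_
      nlinarith [norm_nonneg s]
    have h6 : ‖1 - s‖ ≤ 1 :=
      (CStarAlgebra.norm_le_one_iff_of_nonneg _ (sub_nonneg.2 h3)).2 (sub_le_self _ hs)
    have h7 := CStarRing.norm_star_mul_self (x := s + Complex.I • b - 1)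
    rw [h2, norm_smul] at h7
    have : ‖(2 : ℂ)‖ = 2 := by simp
    rw [this] at h7
    nlinarith [norm_nonneg (s + Complex.I • b - 1)]

lemma conjL_add_conjL_mem [PartialOrder A] [StarOrderedRing A] {s b : A} (hs : 0 ≤ s)
    (hb : IsSelfAdjoint b) (hc : s * b = b * s) (h1 : s * s + b * b = 1) :
    conjL b + conjL s ∈ avgMaps (expMonoid A) := by
  have hs' : IsSelfAdjoint s := .of_nonneg hs
  have m1 := conjL_mem_avgMaps (add_I_smul_mem_expMonoid hs hb hc h1)
  have m2 := conjL_mem_avgMaps (add_I_smul_mem_expMonoid hs hb.neg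
    (by simpa using hc) (by simpa using h1))
  have : conjL b + conjL s = (1 / 2 : ℝ) • conjL (s + Complex.I • b)
      + (1 / 2 : ℝ) • conjL (s + Complex.I • (-b)) := by
    ext c
    have hI : Complex.I • Complex.I • (b * c * b) = -(b * c * b) := by
      rw [smul_smul, Complex.I_mul_I, neg_one_smul]
    simp [hs'.star_eq, hb.star_eq, add_mul, mul_add, hI]
    module
  rw [this]
  exact convex_avgMaps _ m1 m2 (by norm_num) (by norm_num) (by norm_num)

lemma exists_quarter_conjL [PartialOrder A] [StarOrderedRing A] {u : A} (hu : u ∈ unitary A) :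
    ∃ R ∈ avgMaps (unitary A), (1 / 4 : ℝ) • conjL u + (3 / 4 : ℝ) • R ∈ avgMaps (expMonoid A) := by
  obtain ⟨h, k, hh, hk, rfl⟩ : ∃ h k : A, IsSelfAdjoint h ∧ IsSelfAdjoint k ∧
      u = h + Complex.I • k :=
    ⟨realPart u, imaginaryPart u, (realPart u).2, (imaginaryPart u).2,
      (realPart_add_I_smul_imaginaryPart u).symm⟩
  have hst : star (h + Complex.I • k) = h - Complex.I • k := by
    simp [hh.star_eq, hk.star_eq, sub_eq_add_neg]
  have hI : Complex.I • Complex.I • (k * k) = -(k * k) := by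
    rw [smul_smul, Complex.I_mul_I, neg_one_smul]
  rw [Unitary.mem_iff, hst] at hu
  obtain ⟨e1, e2⟩ := hu
  simp only [add_mul, mul_sub, sub_mul, mul_add, smul_mul_assoc, mul_smul_comm, smul_add,
    smul_sub, hI] at e1 e2
  have hc : h * k = k * h := by
    have h3 : (2 : ℂ) • Complex.I • (h * k) = (2 : ℂ) • Complex.I • (k * h) := by
      rw [two_smul, two_smul]
      have h4 := e1.trans e2.symm
      rw [← sub_eq_zero] at h4 ⊢
      rw [← h4]; abel
    have h5 := smul_right_injective A (two_ne_zero (α := ℂ)) h3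
    exact smul_right_injective A Complex.I_ne_zero h5
  have h1 : h * h + k * k = 1 := by
    rw [← e1, hc]; abel
  have hah : CFC.abs h * CFC.abs h = h * h := by rw [CFC.abs_mul_abs, hh.star_eq]
  have hak : CFC.abs k * CFC.abs k = k * k := by rw [CFC.abs_mul_abs, hk.star_eq]
  have c1 : Commute (CFC.abs k) h := Commute.cfcAbs_left hc.symm (hh.star_eq.symm ▸ hc.symm)
  have c2 : Commute (CFC.abs h) k := Commute.cfcAbs_left hc (hk.star_eq.symm ▸ hc)
  have c3 : Commute (CFC.abs h) (CFC.abs k) := Commute.cfcAbs_cfcAbs hc (hk.star_eq.symm ▸ hc)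
  have m1 := conjL_add_conjL_mem (CFC.abs_nonneg k) hh c1 (by rw [hak, add_comm, h1])
  have m2 := conjL_add_conjL_mem (CFC.abs_nonneg h) hk c2 (by rw [hah, h1])
  have m3 := conjL_add_conjL_mem (CFC.abs_nonneg h) (.of_nonneg (CFC.abs_nonneg k)) c3
    (by rw [hah, hak, h1])
  have hu' : star (h + Complex.I • k) ∈ unitary A := by
    rw [Unitary.mem_iff, star_star, hst]
    refine ⟨?_, ?_⟩ <;> rw [← h1] <;>
      simp only [add_mul, mul_sub, sub_mul, mul_add, smul_mul_assoc, mul_smul_comm, smul_add,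
        smul_sub,
        hI, hc] <;> abel
  refine ⟨(1 / 3 : ℝ) • conjL (star (h + Complex.I • k)) +
    (2 / 3 : ℝ) • (conjL (CFC.abs k) + conjL (CFC.abs h)), ?_, ?_⟩
  · exact convex_avgMaps _ (conjL_mem_avgMaps hu') (avgMaps_mono expMonoid_le_unitary m3)
      (by norm_num) (by norm_num) (by norm_num)
  · have : (1 / 4 : ℝ) • conjL (h + Complex.I • k) +
        (3 / 4 : ℝ) • ((1 / 3 : ℝ) • conjL (star (h + Complex.I • k)) +
          (2 / 3 : ℝ) • (conjL (CFC.abs k) + conjL (CFC.abs h))) =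
        (1 / 2 : ℝ) • (conjL h + conjL (CFC.abs k)) +
          (1 / 2 : ℝ) • (conjL k + conjL (CFC.abs h)) := by
      have h6 : conjL (h + Complex.I • k) + conjL (star (h + Complex.I • k)) =
          (2 : ℝ) • conjL h + (2 : ℝ) • conjL k := by
        ext c
        have hI : Complex.I • Complex.I • (k * c * k) = -(k * c * k) := by
          rw [smul_smul, Complex.I_mul_I, neg_one_smul]
        simp [hh.star_eq, hk.star_eq, add_mul, mul_add, hI, two_smul]
        abel
      have h7 : conjL (star (h + Complex.I • k)) = (2 : ℝ) • conjL h + (2 : ℝ) • conjL k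
          - conjL (h + Complex.I • k) := by rw [← h6]; abel
      rw [h7]
      module
    rw [this]
    exact convex_avgMaps _ m1 m2 (by norm_num) (by norm_num) (by norm_num)

lemma exists_quarter_avgMaps [PartialOrder A] [StarOrderedRing A] {T : A →L[ℂ] A}
    (hT : T ∈ avgMaps (unitary A)) :
    ∃ R ∈ avgMaps (unitary A), (1 / 4 : ℝ) • T + (3 / 4 : ℝ) • R ∈ avgMaps (expMonoid A) := by
  refine avgMaps_induction (p := fun T => ∃ R ∈ avgMaps (unitary A),
    (1 / 4 : ℝ) • T + (3 / 4 : ℝ) • R ∈ avgMaps (expMonoid A)) ?_ ?_ hT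
  · intro u hu
    exact exists_quarter_conjL hu
  · rintro S T ⟨R, hR, h1⟩ ⟨R', hR', h2⟩ s t hs ht hst
    refine ⟨s • R + t • R', convex_avgMaps _ hR hR' hs ht hst, ?_⟩
    have := convex_avgMaps _ h1 h2 hs ht hst
    convert this using 1
    module

/-- If `A` has the Dixmier property, then averaging over the monoid generated by exponentials
reduces the distance to the centre. -/
lemma DixmierProperty.exists_contract [PartialOrder A] [StarOrderedRing A]
    (hDP : DixmierProperty A) (c : A) {d : ℝ} (hd : 0 < d)
    (hc : ∃ z ∈ Set.center A, ‖c - z‖ ≤ d) :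
    ∃ Q ∈ avgMaps (expMonoid A), ∃ z ∈ Set.center A, ‖Q c - z‖ ≤ 7 / 8 * d := by
  obtain ⟨z, hz, h1⟩ := hc
  obtain ⟨y, hy, hyz⟩ := hDP c
  rw [dixmierSet_eq_dixSet, mem_dixSet_iff] at hy
  obtain ⟨T, hT, h2⟩ := hy (d / 2) (by positivity)
  obtain ⟨R, hR, hQ⟩ := exists_quarter_avgMaps hT
  refine ⟨_, hQ, (1 / 4 : ℝ) • y + (3 / 4 : ℝ) • z, ?_, ?_⟩
  · have hc : ∀ (r : ℝ) {x : A}, x ∈ Set.center A → r • x ∈ Set.center A := fun r x hx =>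
      Set.smul_mem_center r hx
    exact Set.add_mem_center (hc _ hyz) (hc _ hz)
  · have h3 := norm_avgMaps_apply_le le_rfl hR (c - z)
    rw [map_sub, avgMaps_apply_central le_rfl hR hz] at h3
    have h4 : ((1 / 4 : ℝ) • T + (3 / 4 : ℝ) • R) c - ((1 / 4 : ℝ) • y + (3 / 4 : ℝ) • z) =
        (1 / 4 : ℝ) • (T c - y) + (3 / 4 : ℝ) • (R c - z) := by
      simp only [add_apply, smul_apply]
      module
    rw [h4]
    refine (norm_add_le _ _).trans ?_
    rw [norm_smul, norm_smul]
    norm_num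
    linarith

lemma DixmierProperty.exists_near_center [PartialOrder A] [StarOrderedRing A]
    (hDP : DixmierProperty A) (c : A) {ε : ℝ} (hε : 0 < ε) :
    ∃ Q ∈ avgMaps (expMonoid A), ∃ z ∈ Set.center A, ‖Q c - z‖ ≤ ε := by
  have key : ∀ n : ℕ, ∃ Q ∈ avgMaps (expMonoid A), ∃ z ∈ Set.center A,
      ‖Q c - z‖ ≤ (7 / 8) ^ n * (‖c‖ + 1) := by
    intro n
    induction n with
    | zero => exact ⟨_, one_mem_avgMaps _, 0, Set.zero_mem_center, by simp⟩
    | succ n ih =>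
      obtain ⟨Q, hQ, hz⟩ := ih
      obtain ⟨Q', hQ', z, hz', h⟩ := hDP.exists_contract (Q c) (d := (7 / 8) ^ n * (‖c‖ + 1))
        (by positivity) hz
      refine ⟨Q'.comp Q, comp_mem_avgMaps hQ' hQ, z, hz', ?_⟩
      rw [pow_succ']
      simpa [mul_assoc] using h
  have hlim : Filter.Tendsto (fun n : ℕ => (7 / 8 : ℝ) ^ n * (‖c‖ + 1)) Filter.atTop (nhds 0) := by
    simpa using (tendsto_pow_atTop_nhds_zero_of_lt_one (by norm_num : (0 : ℝ) ≤ 7 / 8)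
      (by norm_num)).mul_const (‖c‖ + 1)
  obtain ⟨n, hn⟩ := (hlim.eventually (gt_mem_nhds hε)).exists
  obtain ⟨Q, hQ, z, hz, h⟩ := key n
  exact ⟨Q, hQ, z, hz, h.trans hn.le⟩

/-- The Dixmier property for the monoid generated by exponentials. -/
lemma DixmierProperty.exists_mem_dixSet [PartialOrder A] [StarOrderedRing A]
    (hDP : DixmierProperty A) (a : A) : (dixSet (expMonoid A) a ∩ Set.center A).Nonempty := by
  have step : ∀ (n : ℕ) (c : A), ∃ Q ∈ avgMaps (expMonoid A), ∃ z ∈ Set.center A,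
      ‖Q c - z‖ ≤ (1 / 2) ^ n := fun n c => hDP.exists_near_center c (by positivity)
  choose Q hQ z hz hn using step
  let c : ℕ → A := fun n => Nat.rec a (fun n c => Q n c c) n
  have hc : ∀ n, c (n + 1) = Q n (c n) (c n) := fun n => rfl
  have hmem : ∀ n, c n ∈ dixSet (expMonoid A) a := by
    intro n
    induction n with
    | zero => exact apply_mem_dixSet (one_mem_avgMaps _) a
    | succ n ih =>
      exact dixSet_subset_of_mem expMonoid_le_unitary ih (apply_mem_dixSet (hQ _ _) _)
  have hd : ∀ n, ‖c (n + 1) - z n (c n)‖ ≤ (1 / 2) ^ n := fun n => hn n (c n)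
  have hstep : ∀ n, dist (c (n + 1)) (c (n + 1 + 1)) ≤ 2 * (1 / 2) ^ n := by
    intro n
    have h1 := norm_avgMaps_apply_le expMonoid_le_unitary (hQ (n + 1) (c (n + 1)))
      (c (n + 1) - z n (c n))
    rw [map_sub, avgMaps_apply_central expMonoid_le_unitary (hQ _ _) (hz _ _), ← hc] at h1
    have h2 := hd n
    have h3 := norm_sub_le (c (n + 1) - z n (c n)) (c (n + 1 + 1) - z n (c n))
    rw [sub_sub_sub_cancel_right] at h3
    rw [dist_eq_norm]
    linarith
  have hcau : CauchySeq fun n => c (n + 1) :=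
    cauchySeq_of_le_geometric (1 / 2) 2 (by norm_num) hstep
  obtain ⟨y, hy⟩ := cauchySeq_tendsto_of_complete hcau
  refine ⟨y, (isClosed_dixSet _ _).mem_of_tendsto hy (.of_forall fun n => hmem (n + 1)), ?_⟩
  have h0 : Filter.Tendsto (fun n => c (n + 1) - z n (c n)) Filter.atTop (nhds 0) :=
    squeeze_zero_norm hd (tendsto_pow_atTop_nhds_zero_of_lt_one (by norm_num) (by norm_num))
  have h1 := hy.sub h0
  simp only [sub_sub_cancel, sub_zero] at h1
  exact isClosed_center.mem_of_tendsto h1 (.of_forall fun n => hz _ _)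

/-! ### Gluing along functions on the spectrum of the centre -/

lemma norm_sum_sq_le {y : ℕ → A} {C : ℝ} (N : ℕ) (hy : ∀ k, ‖y k‖ ≤ C)
    (ho : ∀ j k, j ≠ k → star (y j) * y k = 0) :
    ‖∑ k ∈ Finset.range N, y k‖ ^ 2 ≤ N * C ^ 2 := by
  have h1 : star (∑ k ∈ Finset.range N, y k) * ∑ k ∈ Finset.range N, y k =
      ∑ k ∈ Finset.range N, star (y k) * y k := by
    rw [star_sum, Finset.sum_mul_sum]
    refine Finset.sum_congr rfl fun j hj => ?_
    rw [Finset.sum_eq_single j (fun k _ hk => ho j k hk.symm) (fun h => absurd hj h)]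
  rw [sq, ← CStarRing.norm_star_mul_self, h1]
  refine (norm_sum_le _ _).trans ?_
  have h2 : ∀ k ∈ Finset.range N, ‖star (y k) * y k‖ ≤ C ^ 2 := fun k _ => by
    rw [CStarRing.norm_star_mul_self, ← sq]
    exact pow_le_pow_left₀ (norm_nonneg _) (hy k) 2
  refine (Finset.sum_le_sum h2).trans ?_
  simp

section Model

variable {X : Type*} [TopologicalSpace X]

/-- The function `min 1 (max 0 (f - k))`. -/
def truncC (f : C(X, ℝ)) (k : ℕ) : C(X, ℝ) where
  toFun x := min 1 (max 0 (f x - k))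
  continuous_toFun := by fun_prop

lemma truncC_apply (f : C(X, ℝ)) (k : ℕ) (x : X) : truncC f k x = min 1 (max 0 (f x - k)) := rfl

lemma sum_truncC (f : C(X, ℝ)) (N : ℕ) (h0 : ∀ x, 0 ≤ f x) (h1 : ∀ x, f x ≤ N) :
    ∑ k ∈ Finset.range N, truncC f k = f := by
  ext x
  have key : ∀ n : ℕ, ∑ k ∈ Finset.range n, truncC f k x = min (f x) n := by
    intro n
    induction n with
    | zero => simp [h0 x]
    | succ n ih =>
      rw [Finset.sum_range_succ, ih, truncC_apply]
      push_cast
      rcases le_total (f x) n with h | h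
      · rw [min_eq_left h, max_eq_left (by linarith), min_eq_right (by norm_num), add_zero,
          min_eq_left (by linarith)]
      · rw [min_eq_right h, max_eq_right (by linarith)]
        rcases le_total (f x) (n + 1) with h' | h'
        · rw [min_eq_right (by linarith), min_eq_left h']; ring
        · rw [min_eq_left (by linarith), min_eq_right h']
  rw [ContinuousMap.sum_apply, key, min_eq_left (h1 x)]

lemma truncC_mul_eq_zero (f : C(X, ℝ)) {j k : ℕ} (h : j ≠ k) :
    truncC f j * (1 - truncC f j) * (truncC f k * (1 - truncC f k)) = 0 := by
  wlog hjk : j < k generalizing j k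
  · rw [mul_comm]
    exact this h.symm (lt_of_le_of_ne (not_lt.1 hjk) h.symm)
  ext x
  have hjk' : (j : ℝ) + 1 ≤ k := by exact_mod_cast hjk
  simp only [ContinuousMap.mul_apply, ContinuousMap.sub_apply, ContinuousMap.one_apply,
    ContinuousMap.zero_apply, truncC_apply]
  rcases le_total (f x) k with h' | h'
  · have : min 1 (max 0 (f x - k)) = 0 := by rw [max_eq_left (by linarith)]; norm_num
    rw [this]; ring
  · have : min 1 (max 0 (f x - j)) = 1 := by
      rw [max_eq_right (by linarith), min_eq_left (by linarith)]
    rw [this]; ring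

variable {ι : C(X, ℂ) →⋆ₐ[ℂ] A}

lemma exists_sub_eq_realEmb_mul (hr : Set.range ι = Set.center A) {W v b : A} (a : A)
    {χ : C(X, ℝ)} (h : W - v = realEmb ι χ * b) :
    ∃ d, W * a * star W - v * a * star v = realEmb ι χ * d := by
  refine ⟨b * a * star W + v * a * star b, ?_⟩
  have h1 : star W - star v = realEmb ι χ * star b := by
    rw [← star_sub, h, star_mul, (isSelfAdjoint_realEmb ι χ).star_eq, realEmb_comm hr]
  have h2 : W * a * star W - v * a * star v
      = (W - v) * a * star W + v * a * (star W - star v) := by noncomm_ring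
  rw [h2, h, h1, mul_add, ← mul_assoc (v * a), ← realEmb_comm hr]
  simp only [mul_assoc]

/-- Gluing of two inner maps along a function that takes the values `0` and `1` outside of the
support of `χ * (1 - χ)`. -/
lemma exists_glue_conj (hr : Set.range ι = Set.center A) {v v' : A} (hv : v ∈ expMonoid A)
    (hv' : v' ∈ expMonoid A) (a : A) (χ : C(X, ℝ)) :
    ∃ W ∈ expMonoid A, ∃ d, W * a * star W -
      (realEmb ι χ * (v * a * star v) + realEmb ι (1 - χ) * (v' * a * star v')) =
      realEmb ι (χ * (1 - χ)) * d := by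
  obtain ⟨w, hw, ⟨b, hb⟩, c, hc⟩ := exists_local_expMonoid hr hv χ
  obtain ⟨w', hw', ⟨b', hb'⟩, c', hc'⟩ := exists_local_expMonoid hr hv' (1 - χ)
  rw [sub_sub_cancel] at hc'
  obtain ⟨d, hd⟩ := exists_sub_eq_realEmb_mul (ι := ι) hr (W := w * w') (v := v) a (χ := 1 - χ)
    (b := c * w' + v * b') (by
      rw [mul_add, ← mul_assoc, ← mul_assoc, realEmb_comm hr _ v, mul_assoc v, ← hc, ← hb']
      noncomm_ring)
  obtain ⟨d', hd'⟩ := exists_sub_eq_realEmb_mul (ι := ι) hr (W := w * w') (v := v') a (χ := χ)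
    (b := b * w' + c') (by
      rw [mul_add, ← mul_assoc, ← hb, ← hc']
      noncomm_ring)
  refine ⟨w * w', mul_mem hw hw', d + d', ?_⟩
  have e1 : realEmb ι (χ * (1 - χ)) * d = realEmb ι χ * (realEmb ι (1 - χ) * d) := by
    rw [map_mul, mul_assoc]
  have e2 : realEmb ι (χ * (1 - χ)) * d' = realEmb ι (1 - χ) * (realEmb ι χ * d') := by
    rw [mul_comm χ, map_mul, mul_assoc]
  rw [mul_add, e1, e2, ← hd, ← hd', map_sub, map_one]
  noncomm_ring

variable [CompactSpace X]

lemma norm_realEmb_le (hι : Isometry ι) {χ : C(X, ℝ)} (h0 : ∀ x, 0 ≤ χ x) (h1 : ∀ x, χ x ≤ 1) :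
    ‖realEmb ι χ‖ ≤ 1 := by
  rw [realEmb_apply, (AddMonoidHomClass.isometry_iff_norm ι).1 hι,
    ContinuousMap.norm_le _ zero_le_one]
  intro x
  simpa [abs_of_nonneg (h0 x)] using h1 x

lemma glue_conj_mem_dixSet (hι : Isometry ι) (hr : Set.range ι = Set.center A) {v v' : A}
    (hv : v ∈ expMonoid A) (hv' : v' ∈ expMonoid A) (a : A) {f : C(X, ℝ)}
    (h0 : ∀ x, 0 ≤ f x) (h1 : ∀ x, f x ≤ 1) :
    realEmb ι f * (v * a * star v) + realEmb ι (1 - f) * (v' * a * star v') ∈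
      dixSet (expMonoid A) a := by
  rw [mem_dixSet_iff]
  intro ε hε
  obtain ⟨N, hN⟩ := exists_nat_gt (max 1 ((3 * ‖a‖ / ε) ^ 2))
  have hN1 : (1 : ℝ) < N := (le_max_left _ _).trans_lt hN
  have hN2 : (3 * ‖a‖ / ε) ^ 2 < N := (le_max_right _ _).trans_lt hN
  have hN0 : (0 : ℝ) < N := by linarith
  choose W hW d hd using fun k : ℕ => exists_glue_conj hr hv hv' a (truncC ((N : ℝ) • f) k)
  set χ : ℕ → C(X, ℝ) := fun k => truncC ((N : ℝ) • f) k with hχ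
  set p := v * a * star v with hp
  set p' := v' * a * star v' with hp'
  have norm_conj : ∀ {u : A}, u ∈ expMonoid A → ‖u * a * star u‖ ≤ ‖a‖ := fun {u} hu => by
    simpa using norm_avgMaps_apply_le expMonoid_le_unitary (conjL_mem_avgMaps hu) a
  have hχ0 : ∀ k x, 0 ≤ χ k x := fun k x => le_min zero_le_one (le_max_left _ _)
  have hχ1 : ∀ k x, χ k x ≤ 1 := fun k x => min_le_left _ _
  set y : ℕ → A := fun k => W k * a * star (W k) -
      (realEmb ι (χ k) * p + realEmb ι (1 - χ k) * p') with hy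
  have hyn : ∀ k, ‖y k‖ ≤ 3 * ‖a‖ := by
    intro k
    have e1 := norm_conj (hW k)
    have e2 : ‖realEmb ι (χ k) * p‖ ≤ 1 * ‖a‖ :=
      norm_mul_le_of_le (norm_realEmb_le hι (hχ0 k) (hχ1 k)) (norm_conj hv)
    have e3 : ‖realEmb ι (1 - χ k) * p'‖ ≤ 1 * ‖a‖ :=
      norm_mul_le_of_le (norm_realEmb_le hι (fun x => by simpa using hχ1 k x)
        (fun x => by simpa using hχ0 k x)) (norm_conj hv')
    have e4 := norm_sub_le (W k * a * star (W k)) (realEmb ι (χ k) * p + realEmb ι (1 - χ k) * p')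
    have e5 := norm_add_le (realEmb ι (χ k) * p) (realEmb ι (1 - χ k) * p')
    simp only [hy]
    linarith
  have ho : ∀ j k, j ≠ k → star (y j) * y k = 0 := by
    intro j k hjk
    simp only [hy]
    rw [hd j, hd k, star_mul, (isSelfAdjoint_realEmb ι _).star_eq, mul_assoc,
      ← mul_assoc (realEmb ι _),
      ← map_mul, truncC_mul_eq_zero _ hjk]
    simp
  have hsum := norm_sum_sq_le N hyn ho
  refine ⟨∑ k ∈ Finset.range N, (1 / N : ℝ) • conjL (W k), ?_, ?_⟩
  · refine (convex_avgMaps _).sum_mem (fun _ _ => by positivity) ?_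
      (fun k _ => conjL_mem_avgMaps (hW k))
    simp [hN0.ne']
  · have hs : ∑ k ∈ Finset.range N, χ k = (N : ℝ) • f :=
      sum_truncC _ N (fun x => by have := h0 x; simp; positivity)
        (fun x => by simpa using mul_le_mul_of_nonneg_left (h1 x) hN0.le)
    have hs1 : ∑ k ∈ Finset.range N, realEmb ι (χ k) * p = (N : ℝ) • (realEmb ι f * p) := by
      rw [← Finset.sum_mul, ← map_sum, hs, map_smul, smul_mul_assoc]
    have hs2 : ∑ k ∈ Finset.range N, realEmb ι (1 - χ k) * p' =
        (N : ℝ) • (realEmb ι (1 - f) * p') := by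
      rw [← Finset.sum_mul, ← map_sum, Finset.sum_sub_distrib, hs, ← smul_mul_assoc,
        ← map_smul, smul_sub]
      congr 3
      ext x; simp
    have key : (∑ k ∈ Finset.range N, (1 / N : ℝ) • conjL (W k)) a -
        (realEmb ι f * p + realEmb ι (1 - f) * p') =
        (1 / N : ℝ) • ∑ k ∈ Finset.range N, y k := by
      simp only [hy]
      rw [Finset.sum_sub_distrib, Finset.sum_add_distrib, hs1, hs2, smul_sub, ← smul_add, smul_smul,
        one_div_mul_cancel hN0.ne', one_smul, Finset.smul_sum]
      simp
    rw [key, norm_smul, Real.norm_of_nonneg (by positivity), one_div, inv_mul_lt_iff₀ hN0]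
    refine lt_of_pow_lt_pow_left₀ 2 (by positivity) (hsum.trans_lt ?_)
    rw [div_pow, div_lt_iff₀ (by positivity)] at hN2
    nlinarith

lemma glue_mem_dixSet (hι : Isometry ι) (hr : Set.range ι = Set.center A) {a y y' : A}
    (hy : y ∈ dixSet (expMonoid A) a) (hy' : y' ∈ dixSet (expMonoid A) a) {f : C(X, ℝ)}
    (h0 : ∀ x, 0 ≤ f x) (h1 : ∀ x, f x ≤ 1) :
    realEmb ι f * y + realEmb ι (1 - f) * y' ∈ dixSet (expMonoid A) a := by
  have key : ∀ S ∈ avgMaps (expMonoid A), ∀ T ∈ avgMaps (expMonoid A),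
      realEmb ι f * S a + realEmb ι (1 - f) * T a ∈ dixSet (expMonoid A) a := by
    intro S hS T hT
    refine avgMaps_induction (p := fun S => realEmb ι f * S a + realEmb ι (1 - f) * T a ∈
      dixSet (expMonoid A) a) ?_ ?_ hS
    · intro u hu
      refine avgMaps_induction (p := fun T => realEmb ι f * conjL u a + realEmb ι (1 - f) * T a ∈
        dixSet (expMonoid A) a) ?_ ?_ hT
      · intro v hv
        simp only [conjL_apply]
        exact glue_conj_mem_dixSet hι hr hu hv a h0 h1
      · intro T T' hT hT' s t hs ht hst
        convert convex_dixSet _ _ hT hT' hs ht hst using 1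
        obtain rfl : t = 1 - s := by linarith
        simp only [add_apply, smul_apply, mul_add, mul_smul_comm]
        module
    · intro S S' hS hS' s t hs ht hst
      convert convex_dixSet _ _ hS hS' hs ht hst using 1
      obtain rfl : t = 1 - s := by linarith
      simp only [add_apply, smul_apply, mul_add, mul_smul_comm]
      module
  have hcont : Continuous (Function.uncurry fun y y' : A =>
      realEmb ι f * y + realEmb ι (1 - f) * y') := by
    fun_prop
  have := map_mem_closure₂ (u := dixSet (expMonoid A) a) hcont hy hy' (by
    rintro _ ⟨S, hS, rfl⟩ _ ⟨T, hT, rfl⟩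
    exact key S hS T hT)
  rwa [(isClosed_dixSet _ _).closure_eq] at this

end Model

/-! ### Central values of the averages of an element -/

section CentralValues

variable {X : Type*} [TopologicalSpace X]

/-- The central elements in the closed convex hull of the conjugates of `a` by products of
exponentials, regarded as functions. -/
def centralValues (ι : C(X, ℂ) →⋆ₐ[ℂ] A) (a : A) : Set C(X, ℂ) :=
  {g | ι g ∈ dixSet (expMonoid A) a}

variable {ι : C(X, ℂ) →⋆ₐ[ℂ] A}

lemma mem_centralValues_iff {a : A} {g : C(X, ℂ)} :
    g ∈ centralValues ι a ↔ ∀ ε > 0, ∃ T ∈ avgMaps (expMonoid A), ‖T a - ι g‖ < ε :=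
  mem_dixSet_iff

lemma centralValues_apply_subset {T : A →L[ℂ] A} (hT : T ∈ avgMaps (expMonoid A)) (a : A) :
    centralValues ι (T a) ⊆ centralValues ι a := fun _ hg =>
  dixSet_subset_of_mem expMonoid_le_unitary (apply_mem_dixSet hT a) hg

lemma smul_mem_centralValues {a : A} {g : C(X, ℂ)} (hg : g ∈ centralValues ι a) (c : ℂ) :
    c • g ∈ centralValues ι (c • a) := by
  rw [mem_centralValues_iff] at *
  intro ε hε
  obtain ⟨T, hT, h⟩ := hg (ε / (‖c‖ + 1)) (by positivity)
  refine ⟨T, hT, ?_⟩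
  rw [map_smul, map_smul, ← smul_sub, norm_smul]
  rw [lt_div_iff₀ (by positivity)] at h
  nlinarith [norm_nonneg (T a - ι g)]

lemma exists_avgMaps_conjL {u : A} (hu : u ∈ unitary A) {T : A →L[ℂ] A}
    (hT : T ∈ avgMaps (expMonoid A)) :
    ∃ T' ∈ avgMaps (expMonoid A), ∀ c, T (conjL u c) = conjL u (T' c) := by
  refine avgMaps_induction (p := fun T => ∃ T' ∈ avgMaps (expMonoid A), ∀ c,
    T (conjL u c) = conjL u (T' c)) ?_ ?_ hT
  · intro v hv
    refine ⟨_, conjL_mem_avgMaps (conj_mem_expMonoid ⟨star u, Unitary.star_mem hu⟩ hv), fun c => ?_⟩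
    have h1 : ∀ d, u * (star u * d) = d := fun d => by
      rw [← mul_assoc, Unitary.mul_star_self_of_mem hu, one_mul]
    simp [mul_assoc, h1, Unitary.mul_star_self_of_mem hu]
  · rintro S T ⟨S', hS', h1⟩ ⟨T', hT', h2⟩ s t hs ht hst
    refine ⟨_, convex_avgMaps _ hS' hT' hs ht hst, fun c => ?_⟩
    rw [add_apply, smul_apply, smul_apply, h1, h2]
    simp [mul_add, add_mul]

lemma self_mem_centralValues (g : C(X, ℂ)) : g ∈ centralValues ι (ι g) :=
  apply_mem_dixSet (one_mem_avgMaps _) (ι g)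

variable [CompactSpace X]

/-- `ι` identifies `C(X, ℂ)` with the centre of the C*-algebra `A`, which has the Dixmier
property. -/
structure IsDixmierModel {X : Type*} [TopologicalSpace X] [CompactSpace X]
    (ι : C(X, ℂ) →⋆ₐ[ℂ] A) : Prop where
  isometry : Isometry ι
  range_eq : Set.range ι = Set.center A
  dixmier : DixmierProperty A

variable (H : IsDixmierModel ι)
include H

lemma IsDixmierModel.map_mem_center (g : C(X, ℂ)) : ι g ∈ Set.center A :=
  H.range_eq ▸ Set.mem_range_self g

lemma IsDixmierModel.norm_map (g : C(X, ℂ)) : ‖ι g‖ = ‖g‖ :=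
  (AddMonoidHomClass.isometry_iff_norm ι).1 H.isometry g

lemma IsDixmierModel.nonempty [PartialOrder A] [StarOrderedRing A] (a : A) :
    (centralValues ι a).Nonempty := by
  obtain ⟨z, hz, hz'⟩ := H.dixmier.exists_mem_dixSet a
  rw [← H.range_eq] at hz'
  obtain ⟨g, rfl⟩ := hz'
  exact ⟨g, hz⟩

lemma IsDixmierModel.isClosed (a : A) : IsClosed (centralValues ι a) :=
  (isClosed_dixSet _ a).preimage H.isometry.continuous

lemma IsDixmierModel.glue {a : A} {g g' : C(X, ℂ)} (hg : g ∈ centralValues ι a)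
    (hg' : g' ∈ centralValues ι a) {f : C(X, ℝ)} (h0 : ∀ x, 0 ≤ f x) (h1 : ∀ x, f x ≤ 1) :
    toC f * g + (1 - toC f) * g' ∈ centralValues ι a := by
  have := glue_mem_dixSet H.isometry H.range_eq hg hg' h0 h1
  have e : realEmb ι f * ι g + realEmb ι (1 - f) * ι g' =
      ι (toC f * g + (1 - toC f) * g') := by
    simp only [realEmb_apply, map_sub, map_one, map_mul, map_add]
  rwa [e] at this

lemma IsDixmierModel.norm_sub_le {a : A} {g : C(X, ℂ)} (hg : g ∈ centralValues ι a)
    (h : C(X, ℂ)) : ‖g - h‖ ≤ ‖a - ι h‖ := by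
  refine le_of_forall_pos_le_add fun ε hε => ?_
  obtain ⟨T, hT, h1⟩ := mem_centralValues_iff.1 hg ε hε
  have h2 := norm_avgMaps_apply_le expMonoid_le_unitary hT (a - ι h)
  rw [map_sub, avgMaps_apply_central expMonoid_le_unitary hT (H.map_mem_center h)] at h2
  rw [← H.norm_map, map_sub]
  have h3 : ι g - ι h = (T a - ι h) - (T a - ι g) := by abel
  rw [h3]
  linarith [_root_.norm_sub_le (T a - ι h) (T a - ι g)]

lemma IsDixmierModel.eq_of_mem {g h : C(X, ℂ)} (hg : g ∈ centralValues ι (ι h)) : g = h := by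
  have := H.norm_sub_le hg h
  rwa [sub_self, norm_zero, norm_le_zero_iff, sub_eq_zero] at this

lemma IsDixmierModel.exists_joint [PartialOrder A] [StarOrderedRing A] {a : A} {g : C(X, ℂ)}
    (hg : g ∈ centralValues ι a) (b : A) {ε : ℝ} (hε : 0 < ε) :
    ∃ T ∈ avgMaps (expMonoid A), ‖T a - ι g‖ < ε ∧ ∃ h ∈ centralValues ι b, ‖T b - ι h‖ < ε := by
  obtain ⟨S, hS, h1⟩ := mem_centralValues_iff.1 hg ε hε
  obtain ⟨h, hh⟩ := H.nonempty (S b)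
  obtain ⟨R, hR, h2⟩ := mem_centralValues_iff.1 hh ε hε
  refine ⟨R.comp S, comp_mem_avgMaps hR hS, ?_, h, centralValues_apply_subset hS b hh, h2⟩
  have h3 := norm_avgMaps_apply_le expMonoid_le_unitary hR (S a - ι g)
  rw [map_sub, avgMaps_apply_central expMonoid_le_unitary hR (H.map_mem_center g)] at h3
  exact h3.trans_lt h1

lemma IsDixmierModel.exists_add [PartialOrder A] [StarOrderedRing A] {a b : A} {g : C(X, ℂ)}
    (hg : g ∈ centralValues ι (a + b)) {ε : ℝ} (hε : 0 < ε) :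
    ∃ g₁ ∈ centralValues ι a, ∃ g₂ ∈ centralValues ι b, ‖g - (g₁ + g₂)‖ < ε := by
  obtain ⟨T, hT, h1, g₁, hg₁, h2⟩ := H.exists_joint hg a (half_pos hε)
  obtain ⟨g₂, hg₂⟩ := H.nonempty (T b)
  refine ⟨g₁, hg₁, g₂, centralValues_apply_subset hT b hg₂, ?_⟩
  have h3 := H.norm_sub_le hg₂ (g - g₁)
  have h4 : T b - ι (g - g₁) = (T (a + b) - ι g) - (T a - ι g₁) := by
    rw [map_add, map_sub]; abel
  rw [h4] at h3
  have h5 : g - (g₁ + g₂) = - (g₂ - (g - g₁)) := by abel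
  rw [h5, norm_neg]
  linarith [_root_.norm_sub_le (T (a + b) - ι g) (T a - ι g₁)]

lemma IsDixmierModel.conj_mem {a u : A} (hu : u ∈ unitary A) {g : C(X, ℂ)}
    (hg : g ∈ centralValues ι (conjL u a)) : g ∈ centralValues ι a := by
  rw [mem_centralValues_iff] at *
  intro ε hε
  obtain ⟨T, hT, h⟩ := hg ε hε
  obtain ⟨T', hT', h'⟩ := exists_avgMaps_conjL hu hT
  refine ⟨T', hT', ?_⟩
  have h1 : conjL u (ι g) = ι g := by
    rw [conjL_apply, ← central_comm H.range_eq, mul_assoc,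
      Unitary.mul_star_self_of_mem hu, mul_one]
  rw [h', ← h1, ← map_sub, conjL_apply, CStarRing.norm_mul_mem_unitary _ (Unitary.star_mem hu),
    CStarRing.norm_mem_unitary_mul _ hu] at h
  exact h

lemma IsDixmierModel.re_nonneg [PartialOrder A] [StarOrderedRing A] {a : A} (ha : 0 ≤ a)
    {g : C(X, ℂ)} (hg : g ∈ centralValues ι a) (x : X) : 0 ≤ (g x).re := by
  have h1 := H.norm_sub_le hg (algebraMap ℂ C(X, ℂ) (‖a‖ : ℝ))
  have h2 : ‖a - ι (algebraMap ℂ C(X, ℂ) (‖a‖ : ℝ))‖ ≤ ‖a‖ := by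
    have hc : ι (algebraMap ℂ C(X, ℂ) (‖a‖ : ℝ)) = algebraMap ℝ A ‖a‖ := by
      rw [AlgHomClass.commutes]; rfl
    rw [hc, norm_sub_rev]
    refine (CStarAlgebra.norm_le_norm_of_nonneg_of_le (b := algebraMap ℝ A ‖a‖) ?_ ?_).trans ?_
    · exact sub_nonneg.2 (IsSelfAdjoint.of_nonneg ha).le_algebraMap_norm_self
    · exact sub_le_self _ ha
    · rcases subsingleton_or_nontrivial A with _ | _
      · simp [Subsingleton.elim a 0]
      · simp [norm_algebraMap']
  have h3 := (ContinuousMap.norm_coe_le_norm _ x).trans (h1.trans h2)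
  have h4 := Complex.abs_re_le_norm ((g - algebraMap ℂ C(X, ℂ) (‖a‖ : ℝ)) x)
  have h5 : ((g - algebraMap ℂ C(X, ℂ) (‖a‖ : ℝ)) x).re = (g x).re - ‖a‖ := by
    simp
  rw [h5] at h4
  linarith [neg_abs_le ((g x).re - ‖a‖)]

lemma IsDixmierModel.star_eq {a : A} (ha : IsSelfAdjoint a) {g : C(X, ℂ)}
    (hg : g ∈ centralValues ι a) : star g = g := by
  have key : ∀ ε > 0, ‖star g - g‖ ≤ 2 * ε := by
    intro ε hε
    obtain ⟨T, hT, h⟩ := mem_centralValues_iff.1 hg ε hε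
    have h1 : star (T a) = T a := by rw [← avgMaps_apply_star hT, ha.star_eq]
    have h2 : ‖T a - ι (star g)‖ < ε := by
      rw [map_star, ← h1, ← star_sub, norm_star, ← h1]
      simpa [h1] using h
    rw [← H.norm_map, map_sub]
    have h3 : ι (star g) - ι g = (T a - ι g) - (T a - ι (star g)) := by abel
    rw [h3]
    linarith [_root_.norm_sub_le (T a - ι g) (T a - ι (star g))]
  have : ‖star g - g‖ ≤ 0 := le_of_forall_pos_le_add fun ε hε => by
    linarith [key (ε / 2) (by positivity)]
  rwa [norm_le_zero_iff, sub_eq_zero] at this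

end CentralValues

/-! ### The upper value functional at a point of the spectrum of the centre -/

section UpperVal

variable {X : Type*} [TopologicalSpace X]

/-- The supremum of the real parts of the central values of `a` at the point `x`. -/
def upperVal (ι : C(X, ℂ) →⋆ₐ[ℂ] A) (x : X) (a : A) : ℝ :=
  sSup ((fun g : C(X, ℂ) => (g x).re) '' centralValues ι a)

variable [CompactSpace X] {ι : C(X, ℂ) →⋆ₐ[ℂ] A} (H : IsDixmierModel ι) (x : X)
include H

lemma IsDixmierModel.le_upperVal {a : A} {g : C(X, ℂ)} (hg : g ∈ centralValues ι a) :
    (g x).re ≤ upperVal ι x a := by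
  refine le_csSup ⟨‖a‖, ?_⟩ ⟨g, hg, rfl⟩
  rintro _ ⟨h, hh, rfl⟩
  have := H.norm_sub_le hh 0
  rw [map_zero, sub_zero, sub_zero] at this
  exact (Complex.re_le_norm _).trans ((ContinuousMap.norm_coe_le_norm _ x).trans this)

variable [PartialOrder A] [StarOrderedRing A]

lemma IsDixmierModel.upperVal_le {a : A} {c : ℝ} (h : ∀ g ∈ centralValues ι a, (g x).re ≤ c) :
    upperVal ι x a ≤ c := by
  refine csSup_le ((H.nonempty a).image _) ?_
  rintro _ ⟨g, hg, rfl⟩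
  exact h g hg

lemma IsDixmierModel.exists_lt_of_lt_upperVal {a : A} {c : ℝ} (h : c < upperVal ι x a) :
    ∃ g ∈ centralValues ι a, c < (g x).re := by
  by_contra! h'
  exact (H.upperVal_le x h').not_gt h

lemma IsDixmierModel.upperVal_add_le (a b : A) :
    upperVal ι x (a + b) ≤ upperVal ι x a + upperVal ι x b := by
  refine H.upperVal_le x fun g hg => le_of_forall_pos_le_add fun ε hε => ?_
  obtain ⟨g₁, h₁, g₂, h₂, h⟩ := H.exists_add hg hε
  have h3 := (Complex.re_le_norm _).trans (ContinuousMap.norm_coe_le_norm (g - (g₁ + g₂)) x)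
  simp only [ContinuousMap.sub_apply, ContinuousMap.add_apply, Complex.sub_re,
    Complex.add_re] at h3
  linarith [H.le_upperVal x h₁, H.le_upperVal x h₂]

lemma IsDixmierModel.upperVal_map (g : C(X, ℂ)) : upperVal ι x (ι g) = (g x).re :=
  le_antisymm (H.upperVal_le x fun _ hh => by rw [H.eq_of_mem hh])
    (H.le_upperVal x (self_mem_centralValues g))

lemma IsDixmierModel.upperVal_algebraMap (c : ℝ) : upperVal ι x ((c : ℂ) • (1 : A)) = c := by
  have := H.upperVal_map x ((c : ℂ) • (1 : C(X, ℂ)))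
  rw [map_smul, map_one] at this
  simpa using this

lemma IsDixmierModel.upperVal_zero : upperVal ι x (0 : A) = 0 := by
  simpa using H.upperVal_algebraMap x 0

lemma IsDixmierModel.upperVal_smul_le {t : ℝ} (ht : 0 ≤ t) (a : A) :
    upperVal ι x ((t : ℂ) • a) ≤ t * upperVal ι x a := by
  rcases ht.eq_or_lt with rfl | ht
  · simp [H.upperVal_zero]
  · refine H.upperVal_le x fun g hg => ?_
    have h1 := smul_mem_centralValues hg ((t⁻¹ : ℝ) : ℂ)
    rw [smul_smul, ← Complex.ofReal_mul, inv_mul_cancel₀ ht.ne', Complex.ofReal_one, one_smul] at h1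
    have h2 := H.le_upperVal x h1
    rw [ContinuousMap.smul_apply, smul_eq_mul, Complex.re_ofReal_mul] at h2
    rwa [inv_mul_le_iff₀ ht] at h2

lemma IsDixmierModel.upperVal_smul {t : ℝ} (ht : 0 < t) (a : A) :
    upperVal ι x ((t : ℂ) • a) = t * upperVal ι x a := by
  refine le_antisymm (H.upperVal_smul_le x ht.le a) ?_
  have h := H.upperVal_smul_le x (inv_nonneg.2 ht.le) ((t : ℂ) • a)
  rw [smul_smul, ← Complex.ofReal_mul, inv_mul_cancel₀ ht.ne', Complex.ofReal_one, one_smul,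
    le_inv_mul_iff₀ ht] at h
  exact h

lemma IsDixmierModel.upperVal_apply_le {T : A →L[ℂ] A} (hT : T ∈ avgMaps (expMonoid A)) (a : A) :
    upperVal ι x (T a) ≤ upperVal ι x a :=
  H.upperVal_le x fun _ hg => H.le_upperVal x (centralValues_apply_subset hT a hg)

lemma IsDixmierModel.upperVal_conj_le {u : A} (hu : u ∈ unitary A) (a : A) :
    upperVal ι x (conjL u a) ≤ upperVal ι x a :=
  H.upperVal_le x fun _ hg => H.le_upperVal x (H.conj_mem hu hg)

lemma IsDixmierModel.upperVal_I_smul {a : A} (ha : IsSelfAdjoint a) :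
    upperVal ι x (Complex.I • a) ≤ 0 := by
  refine H.upperVal_le x fun g hg => ?_
  have h1 := smul_mem_centralValues hg (-Complex.I)
  rw [smul_smul, neg_mul, Complex.I_mul_I, neg_neg, one_smul] at h1
  have h2 := congrArg (fun f : C(X, ℂ) => (f x).im) (H.star_eq ha h1)
  simp at h2
  linarith

lemma IsDixmierModel.upperVal_neg_nonpos {a : A} (ha : 0 ≤ a) : upperVal ι x (-a) ≤ 0 := by
  refine H.upperVal_le x fun g hg => ?_
  have h1 := smul_mem_centralValues hg (-1)
  rw [neg_one_smul, neg_one_smul, neg_neg] at h1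
  have := H.re_nonneg ha h1 x
  simp at this
  linarith

lemma IsDixmierModel.upperVal_mono {a b : A} (hab : a ≤ b) : upperVal ι x a ≤ upperVal ι x b := by
  have h := H.upperVal_add_le x b (-(b - a))
  rw [← sub_eq_add_neg, sub_sub_cancel] at h
  linarith [H.upperVal_neg_nonpos x (sub_nonneg.2 hab)]

lemma IsDixmierModel.upperVal_le_norm (a : A) : upperVal ι x a ≤ ‖a‖ := by
  refine H.upperVal_le x fun g hg => ?_
  have := H.norm_sub_le hg 0
  rw [map_zero, sub_zero, sub_zero] at this
  exact (Complex.re_le_norm _).trans ((ContinuousMap.norm_coe_le_norm _ x).trans this)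

lemma IsDixmierModel.upperVal_le_add_norm (a b : A) :
    upperVal ι x a ≤ upperVal ι x b + ‖a - b‖ := by
  have h := H.upperVal_add_le x b (a - b)
  rw [add_sub_cancel] at h
  linarith [H.upperVal_le_norm x (a - b)]

lemma IsDixmierModel.continuous_upperVal : Continuous (upperVal ι x : A → ℝ) := by
  refine (LipschitzWith.of_dist_le_mul (K := 1) fun a b => ?_).continuous
  rw [Real.dist_eq, dist_eq_norm, NNReal.coe_one, one_mul, abs_sub_le_iff]
  have := H.upperVal_le_add_norm x b a
  rw [norm_sub_rev] at this
  exact ⟨by linarith [H.upperVal_le_add_norm x a b], by linarith⟩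

/-- The ideal of elements `a` such that all central values of `star a * a` vanish at `x`. -/
def IsDixmierModel.maxIdeal : Submodule ℂ A where
  carrier := {a | upperVal ι x (star a * a) ≤ 0}
  zero_mem' := by simp [H.upperVal_zero]
  add_mem' := by
    intro a b (ha : upperVal ι x (star a * a) ≤ 0) (hb : upperVal ι x (star b * b) ≤ 0)
    have h1 : star (a + b) * (a + b) ≤
        ((2 : ℝ) : ℂ) • (star a * a) + ((2 : ℝ) : ℂ) • (star b * b) := by
      rw [← sub_nonneg]
      have : ((2 : ℝ) : ℂ) • (star a * a) + ((2 : ℝ) : ℂ) • (star b * b) -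
          star (a + b) * (a + b) = star (a - b) * (a - b) := by
        simp only [Complex.ofReal_ofNat, two_smul, star_add, star_sub]
        noncomm_ring
      rw [this]
      exact star_mul_self_nonneg _
    have h2 := H.upperVal_add_le x (((2 : ℝ) : ℂ) • (star a * a)) (((2 : ℝ) : ℂ) • (star b * b))
    rw [H.upperVal_smul x two_pos, H.upperVal_smul x two_pos] at h2
    change upperVal ι x (star (a + b) * (a + b)) ≤ 0
    linarith [H.upperVal_mono x h1]
  smul_mem' := by
    intro c a (ha : upperVal ι x (star a * a) ≤ 0)
    have h1 : star (c • a) * (c • a) = ((‖c‖ ^ 2 : ℝ) : ℂ) • (star a * a) := by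
      rw [star_smul, smul_mul_smul_comm]
      congr 1
      simpa using Complex.conj_mul' c
    change upperVal ι x (star (c • a) * (c • a)) ≤ 0
    rw [h1]
    exact (H.upperVal_smul_le x (by positivity) _).trans
      (mul_nonpos_of_nonneg_of_nonpos (by positivity) ha)

lemma IsDixmierModel.mem_maxIdeal {a : A} :
    a ∈ H.maxIdeal x ↔ upperVal ι x (star a * a) ≤ 0 := Iff.rfl

lemma IsDixmierModel.isClosedTwoSidedIdeal : IsClosedTwoSidedIdeal (H.maxIdeal x) := by
  refine ⟨?_, fun b a ha => ⟨?_, ?_⟩⟩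
  · exact isClosed_le ((H.continuous_upperVal x).comp (by fun_prop)) continuous_const
  · rw [H.mem_maxIdeal] at *
    have h1 : star (b * a) * (b * a) ≤ ((‖star b * b‖ : ℝ) : ℂ) • (star a * a) := by
      have h2 := star_left_conjugate_le_conjugate
        (isSelfAdjoint_le_norm (IsSelfAdjoint.star_mul_self b)) a
      simpa [mul_assoc] using h2
    refine (H.upperVal_mono x h1).trans ((H.upperVal_smul_le x (by positivity) _).trans
      (mul_nonpos_of_nonneg_of_nonpos (by positivity) ha))
  · have hb : b ∈ Submodule.span ℂ (unitary A : Set A) := by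
      rw [CStarAlgebra.span_unitary]; trivial
    induction hb using Submodule.span_induction with
    | mem u hu =>
      rw [H.mem_maxIdeal] at *
      have h1 : star (a * u) * (a * u) = conjL (star u) (star a * a) := by simp [mul_assoc]
      rw [h1]
      exact (H.upperVal_conj_le x (Unitary.star_mem hu) _).trans ha
    | zero => simp
    | add b c _ _ hb hc => rw [mul_add]; exact add_mem hb hc
    | smul c b _ hb => rw [mul_smul_comm]; exact Submodule.smul_mem _ c hb

lemma IsDixmierModel.one_notMem : (1 : A) ∉ H.maxIdeal x := by
  rw [H.mem_maxIdeal]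
  have := H.upperVal_algebraMap x 1
  simp at this
  simp [this]

lemma IsDixmierModel.map_mem_maxIdeal {g : C(X, ℂ)} (hg : g x = 0) : ι g ∈ H.maxIdeal x := by
  rw [H.mem_maxIdeal, ← map_star, ← map_mul, H.upperVal_map]
  simp [hg]

lemma IsDixmierModel.mem_maxIdeal_of_nonneg {a : A} (ha : 0 ≤ a) (h : upperVal ι x a ≤ 0) :
    a ∈ H.maxIdeal x := by
  rw [H.mem_maxIdeal, (IsSelfAdjoint.of_nonneg ha).star_eq]
  have h1 : a * a ≤ ((‖a‖ : ℝ) : ℂ) • a := by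
    rw [← sub_nonneg]
    have h2 : Commute (((‖a‖ : ℝ) : ℂ) • (1 : A) - a) a :=
      ((Commute.one_left a).smul_left _).sub_left (Commute.refl a)
    have h3 := h2.mul_nonneg (sub_nonneg.2 (isSelfAdjoint_le_norm (IsSelfAdjoint.of_nonneg ha))) ha
    simpa [sub_mul] using h3
  exact (H.upperVal_mono x h1).trans ((H.upperVal_smul_le x (norm_nonneg a) _).trans
      (mul_nonpos_of_nonneg_of_nonpos (norm_nonneg a) h))

lemma IsDixmierModel.upperVal_add_star_le {m : A} (hm : m ∈ H.maxIdeal x) :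
    upperVal ι x (m + star m) ≤ 0 := by
  refine le_of_forall_pos_le_add fun ε hε => ?_
  have h1 : ((ε : ℝ) : ℂ) • (m + star m) ≤ ((ε ^ 2 : ℝ) : ℂ) • (1 : A) + star m * m := by
    rw [← sub_nonneg]
    have h2 := star_mul_self_nonneg ((ε : ℂ) • (1 : A) - m)
    convert h2 using 1
    simp only [star_sub, star_smul, star_one, sub_mul, mul_sub, smul_mul_assoc, mul_smul_comm,
      smul_smul, one_mul, mul_one, smul_sub, smul_add, sq, Complex.ofReal_mul]
    simp only [RCLike.star_def, Complex.conj_ofReal]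
    abel
  have h3 := H.upperVal_mono x h1
  have h4 := H.upperVal_add_le x (((ε ^ 2 : ℝ) : ℂ) • (1 : A)) (star m * m)
  rw [H.upperVal_smul x hε] at h3
  rw [H.upperVal_algebraMap] at h4
  have h5 : upperVal ι x (star m * m) ≤ 0 := hm
  nlinarith

lemma IsDixmierModel.upperVal_re_le (a : A) :
    upperVal ι x a ≤ upperVal ι x (((2⁻¹ : ℝ) : ℂ) • (a + star a)) := by
  have h1 : a = ((2⁻¹ : ℝ) : ℂ) • (a + star a) +
      Complex.I • (((2⁻¹ : ℝ) : ℂ) • (Complex.I • (star a - a))) := by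
    rw [smul_comm Complex.I, smul_smul Complex.I, Complex.I_mul_I]
    push_cast
    module
  conv_lhs => rw [h1]
  refine (H.upperVal_add_le x _ _).trans (add_le_of_nonpos_right (H.upperVal_I_smul x ?_))
  rw [isSelfAdjoint_iff]
  simp only [star_smul, star_sub, star_star, RCLike.star_def, Complex.conj_ofReal, Complex.conj_I]
  module

lemma IsDixmierModel.upperVal_nonpos_of_mem {m : A} (hm : m ∈ H.maxIdeal x) :
    upperVal ι x m ≤ 0 :=
  (H.upperVal_re_le x m).trans ((H.upperVal_smul_le x (by norm_num) _).trans
    (mul_nonpos_of_nonneg_of_nonpos (by norm_num) (H.upperVal_add_star_le x hm)))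

lemma IsDixmierModel.isMaximalClosedIdeal : IsMaximalClosedIdeal (H.maxIdeal x) := by
  refine ⟨H.isClosedTwoSidedIdeal x, fun h => H.one_notMem x (h ▸ trivial), ?_⟩
  intro J hJ hJ1 hMJ
  refine le_antisymm (fun a ha => ?_) hMJ
  by_contra ha'
  rw [H.mem_maxIdeal, not_le] at ha'
  obtain ⟨g, hg, hgx⟩ := H.exists_lt_of_lt_upperVal x ha'
  have h1 : ι g ∈ J := by
    have h2 : dixSet (expMonoid A) (star a * a) ⊆ J := by
      refine closure_minimal ?_ hJ.1
      rintro _ ⟨T, hT, rfl⟩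
      exact avgMaps_apply_mem hT hJ.2 (hJ.2 _ _ ha).1
    exact h2 hg
  have h3 : ι (g - algebraMap ℂ _ (g x)) ∈ J := hMJ (H.map_mem_maxIdeal x (by simp))
  have h4 : (g x) • (1 : A) ∈ J := by
    have := J.sub_mem h1 h3
    rw [← map_sub, sub_sub_cancel, AlgHomClass.commutes, Algebra.algebraMap_eq_smul_one] at this
    exact this
  have h5 : (1 : A) ∈ J := by
    have h6 : g x ≠ 0 := fun h => by simp [h] at hgx
    simpa [smul_smul, inv_mul_cancel₀ h6] using J.smul_mem (g x)⁻¹ h4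
  exact hJ1 (eq_top_iff.2 fun b _ => by simpa using (hJ.2 b 1 h5).1)

end UpperVal

/-! ### States dominated by the upper value functional -/

section DominatedStates

lemma isTracialState_of_star_mul {ρ : A →L[ℂ] ℂ} (hρ : IsState ρ)
    (h : ∀ a : A, (ρ (star a * a - a * star a)).re = 0) : IsTracialState ρ := by
  refine ⟨hρ.1, hρ.2, fun a b => ?_⟩
  have h0 : ∀ a : A, ρ (star a * a) = ρ (a * star a) := fun a => by
    have h1 := Complex.nonneg_iff.1 (hρ.2 a)
    have h2 := hρ.2 (star a)
    rw [star_star, Complex.nonneg_iff] at h2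
    have h3 := h a
    rw [map_sub, Complex.sub_re] at h3
    exact Complex.ext (by linarith) (by rw [← h1.2, ← h2.2])
  obtain ⟨a, rfl⟩ : ∃ c, a = star c := ⟨star a, (star_star a).symm⟩
  have e0 := h0 a
  have e1 := h0 b
  have e2 := h0 (a + b)
  have e3 := h0 (a + Complex.I • b)
  simp only [star_add, star_smul, add_mul, mul_add, smul_mul_assoc, mul_smul_comm, map_add,
    map_smul, smul_eq_mul, RCLike.star_def, Complex.conj_I] at e2 e3
  linear_combination (1 / 2 : ℂ) * (e2 - e0 - e1) +
    (-Complex.I / 2) * (e3 - e0 - e1) +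
    (ρ (star a * b) - ρ (b * star a) + ρ (a * star b) - ρ (star b * a) +
      (ρ (b * star b) - ρ (star b * b)) * Complex.I) / 2 * Complex.I_mul_I

variable {X : Type*} [TopologicalSpace X] [CompactSpace X] {ι : C(X, ℂ) →⋆ₐ[ℂ] A}
  [PartialOrder A] [StarOrderedRing A] (H : IsDixmierModel ι) (x : X)
include H

/-- A real functional dominated by the upper value functional is the real part of a state. -/
lemma IsDixmierModel.exists_state_of_le_upperVal {φ : A →ₗ[ℝ] ℝ}
    (hφ : ∀ a, φ a ≤ upperVal ι x a) :
    ∃ ρ : A →L[ℂ] ℂ, IsState ρ ∧ (∀ m ∈ H.maxIdeal x, ρ m = 0) ∧ ∀ a, (ρ a).re = φ a := by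
  have hre : ∀ a, (Module.Dual.extendRCLike (𝕜 := ℂ) φ a).re = φ a := fun a => by
    simp [Module.Dual.extendRCLike_apply]
  have him : ∀ a, (Module.Dual.extendRCLike (𝕜 := ℂ) φ a).im = -φ (Complex.I • a) := fun a => by
    simp [Module.Dual.extendRCLike_apply]
  let ρ : A →L[ℂ] ℂ := (Module.Dual.extendRCLike (𝕜 := ℂ) φ).mkContinuous 1
    (norm_apply_le_of_re_le fun a => by
      rw [hre, one_mul]; exact (hφ a).trans (H.upperVal_le_norm x a))
  have hre' : ∀ a, (ρ a).re = φ a := hre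
  have him' : ∀ a, (ρ a).im = -φ (Complex.I • a) := him
  have hzero : ∀ a, φ a ≤ 0 → φ (-a) ≤ 0 → φ a = 0 := fun a h1 h2 => by
    rw [map_neg] at h2; linarith
  have hI : ∀ a, IsSelfAdjoint a → φ (Complex.I • a) = 0 := fun a ha => by
    refine hzero _ ((hφ _).trans (H.upperVal_I_smul x ha)) ?_
    rw [← smul_neg]
    exact (hφ _).trans (H.upperVal_I_smul x ha.neg)
  have hpos : ∀ a : A, 0 ≤ ρ (star a * a) := fun a => by
    rw [Complex.nonneg_iff, hre', him', hI _ (IsSelfAdjoint.star_mul_self a), neg_zero]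
    have := (hφ _).trans (H.upperVal_neg_nonpos x (star_mul_self_nonneg a))
    rw [map_neg] at this
    exact ⟨by linarith, rfl⟩
  refine ⟨ρ, ⟨(isState_iff hpos).2 ?_, hpos⟩, fun m hm => ?_, hre'⟩
  · refine Complex.ext ?_ ?_
    · have h1 := hφ 1
      have h2 := hφ (-1)
      have h3 := H.upperVal_algebraMap x 1
      have h4 := H.upperVal_algebraMap x (-1)
      simp only [Complex.ofReal_one, Complex.ofReal_neg, one_smul, neg_smul] at h3 h4
      rw [map_neg] at h2
      rw [hre', Complex.one_re]
      linarith
    · rw [him', hI _ (IsSelfAdjoint.one A)]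
      simp
  · have hm' : ∀ c : ℂ, φ (c • m) ≤ 0 := fun c =>
      (hφ _).trans (H.upperVal_nonpos_of_mem x (Submodule.smul_mem _ c hm))
    refine Complex.ext ?_ ?_
    · rw [hre', Complex.zero_re]
      exact hzero m (by simpa using hm' 1) (by simpa using hm' (-1))
    · rw [him', hzero _ (hm' Complex.I) (by simpa using hm' (-Complex.I))]
      simp

lemma IsDixmierModel.exists_state (V : Submodule ℝ A) (hV : ∀ v ∈ V, 0 ≤ upperVal ι x v) :
    ∃ ρ : A →L[ℂ] ℂ, IsState ρ ∧ (∀ m ∈ H.maxIdeal x, ρ m = 0) ∧ ∀ v ∈ V, (ρ v).re = 0 := by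
  obtain ⟨φ, h1, h2⟩ := exists_extension_of_le_sublinear ⟨V, 0⟩ (upperVal ι x)
    (fun c hc a => H.upperVal_smul x hc a) (H.upperVal_add_le x) (fun v => hV v v.2)
  obtain ⟨ρ, h3, h4, h5⟩ := H.exists_state_of_le_upperVal x h2
  exact ⟨ρ, h3, h4, fun v hv => by rw [h5]; exact h1 ⟨v, hv⟩⟩

lemma IsDixmierModel.exists_upperVal_neg
    (hY : ¬ ∃ τ : A →L[ℂ] ℂ, IsTracialState τ ∧ ∀ m ∈ H.maxIdeal x, τ m = 0) :
    ∃ v ∈ Submodule.span ℝ (Set.range fun a : A => star a * a - a * star a),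
      upperVal ι x v < 0 := by
  by_contra! hV
  obtain ⟨ρ, h1, h2, h3⟩ := H.exists_state x _ hV
  exact hY ⟨ρ, isTracialState_of_star_mul h1 fun a =>
    h3 _ (Submodule.subset_span ⟨a, rfl⟩), h2⟩

end DominatedStates

/-! ### Pairs of completely positive maps and tangent directions -/

/-- `DualPair Φ Ψ` holds if `Φ c = ∑ i, star (x i) * c * x i` and `Ψ c = ∑ i, x i * c * star (x i)`
for some finite family `x`. -/
inductive DualPair : (A →L[ℂ] A) → (A →L[ℂ] A) → Prop
  | conj (x : A) : DualPair (conjL (star x)) (conjL x)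
  | add {Φ Ψ Φ' Ψ' : A →L[ℂ] A} (h : DualPair Φ Ψ) (h' : DualPair Φ' Ψ') :
      DualPair (Φ + Φ') (Ψ + Ψ')

namespace DualPair

variable {Φ Ψ Φ' Ψ' : A →L[ℂ] A}

lemma symm (h : DualPair Φ Ψ) : DualPair Ψ Φ := by
  induction h with
  | conj x => simpa using DualPair.conj (star x)
  | add _ _ h h' => exact h.add h'

lemma smul (h : DualPair Φ Ψ) {t : ℝ} (ht : 0 ≤ t) : DualPair (t • Φ) (t • Ψ) := by
  induction h with
  | conj x =>
    have e : ∀ y : A, conjL ((√t : ℂ) • y) = t • conjL y := fun y => by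
      ext c
      simp only [conjL_apply, smul_apply, star_smul, smul_mul_assoc, mul_smul_comm, smul_smul,
        RCLike.star_def, Complex.conj_ofReal]
      rw [← Complex.ofReal_mul, Real.mul_self_sqrt ht, Complex.coe_smul]
    have := DualPair.conj ((√t : ℂ) • x)
    rwa [star_smul, RCLike.star_def, Complex.conj_ofReal, e, e] at this
  | add _ _ h h' => simpa only [smul_add] using h.add h'

lemma comp (h : DualPair Φ Ψ) (h' : DualPair Φ' Ψ') : DualPair (Φ'.comp Φ) (Ψ.comp Ψ') := by
  induction h with
  | conj x =>
    induction h' with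
    | conj y =>
      rw [← conjL_mul, ← conjL_mul, ← star_mul]
      exact .conj _
    | add _ _ h h' =>
      rw [ContinuousLinearMap.add_comp, ContinuousLinearMap.comp_add]
      exact h.add h'
  | add _ _ h h' =>
    rw [ContinuousLinearMap.add_comp, ContinuousLinearMap.comp_add]
    exact h.add h'

lemma apply_mem (h : DualPair Φ Ψ) {M : Submodule ℂ A}
    (hM : ∀ a b : A, b ∈ M → a * b ∈ M ∧ b * a ∈ M) {c : A} (hc : c ∈ M) : Φ c ∈ M := by
  induction h with
  | conj x => rw [conjL_apply]; exact (hM _ _ (hM _ _ hc).1).2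
  | add _ _ h h' => exact M.add_mem h h'

lemma apply_nonneg [PartialOrder A] [StarOrderedRing A] (h : DualPair Φ Ψ) {c : A} (hc : 0 ≤ c) :
    0 ≤ Φ c := by
  induction h with
  | conj x => rw [conjL_apply]; exact star_right_conjugate_nonneg hc _
  | add _ _ h h' => exact add_nonneg h h'

lemma mono [PartialOrder A] [StarOrderedRing A] (h : DualPair Φ Ψ) {c d : A} (hcd : c ≤ d) :
    Φ c ≤ Φ d := by
  have := h.apply_nonneg (sub_nonneg.2 hcd)
  rwa [map_sub, sub_nonneg] at this

lemma apply_star (h : DualPair Φ Ψ) (c : A) : Φ (star c) = star (Φ c) := by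
  induction h with
  | conj x => simp [mul_assoc]
  | add _ _ h h' => simp [h, h']

lemma exists_of_avgMaps {P : Submonoid A} {T : A →L[ℂ] A} (hT : T ∈ avgMaps P) :
    ∃ S, DualPair T S := by
  refine avgMaps_induction (p := fun T => ∃ S, DualPair T S) (fun u _ => ⟨_, (conj u).symm⟩) ?_ hT
  rintro S T ⟨S', hS⟩ ⟨T', hT⟩ s t hs ht _
  exact ⟨_, (hS.smul hs).add (hT.smul ht)⟩

lemma exists_avgMaps_apply_one {T : A →L[ℂ] A} (hT : T ∈ avgMaps (expMonoid A))
    (h : DualPair Φ Ψ) : ∃ Φ' Ψ', DualPair Φ' Ψ' ∧ Φ' 1 = T (Φ 1) ∧ Ψ' 1 = T (Ψ 1) := by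
  refine avgMaps_induction
    (p := fun T => ∃ Φ' Ψ', DualPair Φ' Ψ' ∧ Φ' 1 = T (Φ 1) ∧ Ψ' 1 = T (Ψ 1)) ?_ ?_ hT
  · intro u hu
    have hu1 : star u * u = 1 := (Unitary.mem_iff.1 (expMonoid_le_unitary hu)).1
    have h1 : conjL (star u) 1 = 1 := by simp [hu1]
    exact ⟨_, _, ((conj u).comp h).comp (conj u).symm, by simp [hu1], by simp [hu1]⟩
  · rintro S T ⟨Φ₁, Ψ₁, h₁, e₁, e₁'⟩ ⟨Φ₂, Ψ₂, h₂, e₂, e₂'⟩ s t hs ht _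
    exact ⟨_, _, (h₁.smul hs).add (h₂.smul ht), by simp [e₁, e₂], by simp [e₁', e₂']⟩

lemma exists_of_mem_span {v : A}
    (hv : v ∈ Submodule.span ℝ (Set.range fun a : A => star a * a - a * star a)) :
    ∃ Φ Ψ : A →L[ℂ] A, DualPair Φ Ψ ∧ v = Φ 1 - Ψ 1 := by
  induction hv using Submodule.span_induction with
  | mem v hv =>
    obtain ⟨a, rfl⟩ := hv
    exact ⟨_, _, conj a, by simp⟩
  | zero => exact ⟨_, _, conj 0, by simp⟩
  | add v w _ _ hv hw =>
    obtain ⟨Φ, Ψ, h, rfl⟩ := hv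
    obtain ⟨Φ', Ψ', h', rfl⟩ := hw
    exact ⟨_, _, h.add h', by simp only [add_apply]; abel⟩
  | smul t v _ hv =>
    obtain ⟨Φ, Ψ, h, rfl⟩ := hv
    rcases le_total 0 t with ht | ht
    · exact ⟨_, _, h.smul ht, by simp [smul_sub]⟩
    · exact ⟨_, _, h.symm.smul (neg_nonneg.2 ht), by simp only [smul_apply]; module⟩

end DualPair

/-- `ℓ` is tangent at `h` to the orbit of `h` under averaging. -/
def IsTangent (h ℓ : A) : Prop :=
  ∃ C t₀ : ℝ, 0 < t₀ ∧ ∀ t, 0 ≤ t → t ≤ t₀ → ∃ T ∈ avgMaps (expMonoid A),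
    ‖T h - h - t • ℓ‖ ≤ C * t ^ 2

lemma IsTangent.add {h ℓ ℓ' : A} (H : IsTangent h ℓ) (H' : IsTangent h ℓ') :
    IsTangent h (ℓ + ℓ') := by
  obtain ⟨C, t₀, h0, H⟩ := H
  obtain ⟨C', t₀', h0', H'⟩ := H'
  refine ⟨2 * (C + C'), min t₀ t₀' / 2, by positivity, fun t ht ht' => ?_⟩
  have h1 := min_le_left t₀ t₀'
  have h2 := min_le_right t₀ t₀'
  obtain ⟨T, hT, e⟩ := H (2 * t) (by linarith) (by linarith)
  obtain ⟨T', hT', e'⟩ := H' (2 * t) (by linarith) (by linarith)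
  refine ⟨_, convex_avgMaps _ hT hT' (by norm_num : (0 : ℝ) ≤ 1 / 2)
    (by norm_num : (0 : ℝ) ≤ 1 / 2) (by norm_num), ?_⟩
  have key : ((1 / 2 : ℝ) • T + (1 / 2 : ℝ) • T') h - h - t • (ℓ + ℓ') =
      (1 / 2 : ℝ) • (T h - h - (2 * t) • ℓ) + (1 / 2 : ℝ) • (T' h - h - (2 * t) • ℓ') := by
    simp only [add_apply, smul_apply]
    module
  rw [key]
  refine (norm_add_le _ _).trans ?_
  rw [norm_smul, norm_smul, Real.norm_of_nonneg (by norm_num : (0 : ℝ) ≤ 1 / 2)]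
  nlinarith

lemma abs_sqrt_one_sub_le {y : ℝ} (h0 : 0 ≤ y) (h1 : y ≤ 1) : |√(1 - y) - 1| ≤ y := by
  have h2 := Real.sqrt_nonneg (1 - y)
  have h3 := Real.sq_sqrt (sub_nonneg.2 h1)
  have h4 : √(1 - y) ≤ 1 := by nlinarith
  rw [abs_le]
  constructor <;> nlinarith

lemma abs_sqrt_one_sub_add_le {y : ℝ} (h0 : 0 ≤ y) (h1 : y ≤ 1) :
    |√(1 - y) - 1 + y / 2| ≤ y ^ 2 := by
  have h2 := Real.sqrt_nonneg (1 - y)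
  have h3 := Real.sq_sqrt (sub_nonneg.2 h1)
  have h4 : √(1 - y) ≤ 1 := by nlinarith
  have h5 : √(1 - y) - 1 + y / 2 = -(1 - √(1 - y)) ^ 2 / 2 := by nlinarith
  have h6 : 1 - √(1 - y) ≤ y := by nlinarith
  rw [h5, abs_le]
  constructor <;> nlinarith [sq_nonneg (1 - √(1 - y))]

lemma isTangent_of_isSelfAdjoint [PartialOrder A] [StarOrderedRing A] {k : A}
    (hk : IsSelfAdjoint k) (h : A) :
    IsTangent h (k * h * k - (1 / 2 : ℝ) • (k * k * h + h * (k * k))) := by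
  set n := ‖k‖ ^ 2 with hn
  have hn0 : 0 ≤ n := by positivity
  refine ⟨3 * n ^ 2 * ‖h‖, 1 / (n + 1), by positivity, fun t ht ht' => ?_⟩
  have htn : t * n ≤ 1 := by
    rw [le_div_iff₀ (by positivity)] at ht'; nlinarith
  have hspec : ∀ r ∈ spectrum ℝ k, 0 ≤ t * r ^ 2 ∧ t * r ^ 2 ≤ t * n := fun r hr => by
    have h1 : r ^ 2 ≤ n := by
      rw [hn, ← sq_abs r]
      have h2 : |r| ≤ ‖k‖ := by
        rcases subsingleton_or_nontrivial A with _ | _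
        · simp [spectrum.of_subsingleton] at hr
        · simpa using spectrum.norm_le_norm_of_mem hr
      gcongr
    exact ⟨by positivity, by gcongr⟩
  set s : A := cfc (fun r : ℝ => √(1 - t * r ^ 2)) k with hs
  set R : A := cfc (fun r : ℝ => √(1 - t * r ^ 2) - 1 + t * r ^ 2 / 2) k with hR
  have hkk : k * k = cfc (fun r : ℝ => r ^ 2) k := by
    rw [cfc_pow_id k 2, sq]
  have hs0 : 0 ≤ s := cfc_nonneg fun r _ => Real.sqrt_nonneg _
  have hsub : cfc (fun r : ℝ => √(1 - t * r ^ 2) - 1) k = s - 1 := by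
    rw [cfc_sub (fun r : ℝ => √(1 - t * r ^ 2)) (fun _ => 1) k, cfc_const_one ℝ k]
  have hmul : ∀ c : ℝ, cfc (fun r : ℝ => c * r ^ 2) k = c • (k * k) := fun c => by
    rw [hkk, cfc_const_mul c (fun r : ℝ => r ^ 2) k]
  have hsR : s - 1 = R - (t / 2) • (k * k) := by
    have e : (fun r : ℝ => √(1 - t * r ^ 2) - 1 + t * r ^ 2 / 2) =
        fun r : ℝ => (√(1 - t * r ^ 2) - 1) + (t / 2) * r ^ 2 := by
      funext r; ring
    rw [hR, e, cfc_add k (fun r : ℝ => √(1 - t * r ^ 2) - 1) (fun r => (t / 2) * r ^ 2), hsub, hmul,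
      add_sub_cancel_right]
  have hs1 : ‖s - 1‖ ≤ t * n := by
    rw [← hsub]
    refine norm_cfc_le (by positivity) fun r hr => ?_
    obtain ⟨h1, h2⟩ := hspec r hr
    exact (abs_sqrt_one_sub_le h1 (h2.trans htn)).trans h2
  have hRn : ‖R‖ ≤ (t * n) ^ 2 := by
    refine norm_cfc_le (by positivity) fun r hr => ?_
    obtain ⟨h1, h2⟩ := hspec r hr
    exact (abs_sqrt_one_sub_add_le h1 (h2.trans htn)).trans (by gcongr)
  have hss : s * s = 1 - t • (k * k) := by
    rw [hs, ← cfc_mul .., ← hmul, ← cfc_const_one ℝ k,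
      ← cfc_sub (fun _ => 1) (fun r : ℝ => t * r ^ 2) k]
    refine cfc_congr fun r hr => ?_
    obtain ⟨h1, h2⟩ := hspec r hr
    exact Real.mul_self_sqrt (by linarith)
  have hsk : s * k = k * s := by
    have := cfc_commute_cfc (fun r : ℝ => √(1 - t * r ^ 2)) id k
    rw [cfc_id ℝ k] at this
    exact this.eq
  have hb : IsSelfAdjoint (√t • k) := (IsSelfAdjoint.all √t).smul hk
  refine ⟨_, conjL_add_conjL_mem (s := s) hs0 hb ?_ ?_, ?_⟩
  · rw [mul_smul_comm, smul_mul_assoc, hsk]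
  · rw [smul_mul_smul_comm, Real.mul_self_sqrt ht, hss, sub_add_cancel]
  · have hs' : star s = s := (IsSelfAdjoint.of_nonneg hs0).star_eq
    have key : (conjL (√t • k) + conjL s) h - h -
        t • (k * h * k - (1 / 2 : ℝ) • (k * k * h + h * (k * k))) =
        R * h + h * R + (s - 1) * h * (s - 1) := by
      rw [add_apply, conjL_apply, conjL_apply, hb.star_eq, hs', smul_mul_assoc, smul_mul_smul_comm,
        Real.mul_self_sqrt ht]
      have e : s * h * s = h + (s - 1) * h + h * (s - 1) + (s - 1) * h * (s - 1) := by
        noncomm_ring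
      have e' : (s - 1) * h + h * (s - 1) =
          R * h + h * R - (t / 2) • (k * k * h + h * (k * k)) := by
        rw [hsR]
        simp only [sub_mul, mul_sub, smul_mul_assoc, mul_smul_comm, smul_add]
        abel
      rw [e, add_assoc h, e']
      module
    rw [key]
    have b1 : ‖R * h‖ ≤ (t * n) ^ 2 * ‖h‖ := norm_mul_le_of_le hRn le_rfl
    have b2 : ‖h * R‖ ≤ ‖h‖ * (t * n) ^ 2 := norm_mul_le_of_le le_rfl hRn
    have b3 : ‖(s - 1) * h * (s - 1)‖ ≤ t * n * ‖h‖ * (t * n) :=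
      norm_mul_le_of_le (norm_mul_le_of_le hs1 le_rfl) hs1
    linarith [norm_add_le (R * h + h * R) ((s - 1) * h * (s - 1)), norm_add_le (R * h) (h * R)]

lemma DualPair.isTangent [PartialOrder A] [StarOrderedRing A] {Φ Ψ : A →L[ℂ] A}
    (H : DualPair Φ Ψ) (h : A) :
    IsTangent h (Φ h + Ψ h - (1 / 2 : ℝ) • ((Φ 1 + Ψ 1) * h + h * (Φ 1 + Ψ 1))) := by
  induction H with
  | conj x =>
    obtain ⟨k₁, k₂, h₁, h₂, rfl⟩ : ∃ k₁ k₂ : A, IsSelfAdjoint k₁ ∧ IsSelfAdjoint k₂ ∧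
        x = k₁ + Complex.I • k₂ :=
      ⟨realPart x, imaginaryPart x, (realPart x).2, (imaginaryPart x).2,
        (realPart_add_I_smul_imaginaryPart x).symm⟩
    have t₁ := isTangent_of_isSelfAdjoint h₁ h
    have t₂ := isTangent_of_isSelfAdjoint h₂ h
    convert (t₁.add t₁).add (t₂.add t₂) using 1
    simp only [conjL_apply, star_add, star_smul, h₁.star_eq, h₂.star_eq, RCLike.star_def,
      Complex.conj_I, add_mul, mul_add, smul_mul_assoc, mul_smul_comm, mul_one]
    match_scalars <;> ring_nf <;> simp [Complex.I_sq] <;> ring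
  | add _ _ h₁ h₂ =>
    convert h₁.add h₂ using 1
    simp only [add_apply, add_mul, mul_add]
    module

/-! ### Pushing averages upwards modulo a traceless maximal ideal -/

section LeMod

variable [PartialOrder A] [StarOrderedRing A]

/-- `b ≤ a` up to an element of `M`. -/
def LeMod (M : Submodule ℂ A) (b a : A) : Prop := ∃ m ∈ M, b + m ≤ a

lemma LeMod.trans {M : Submodule ℂ A} {a b c : A} (h : LeMod M c b) (h' : LeMod M b a) :
    LeMod M c a := by
  obtain ⟨m, hm, h⟩ := h
  obtain ⟨m', hm', h'⟩ := h'
  refine ⟨m + m', M.add_mem hm hm', le_trans ?_ h'⟩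
  rw [← add_assoc]
  exact add_le_add_left h m'

lemma LeMod.smul {M : Submodule ℂ A} {a b : A} (h : LeMod M b a) {t : ℝ} (ht : 0 ≤ t) :
    LeMod M (t • b) (t • a) := by
  obtain ⟨m, hm, h⟩ := h
  exact ⟨t • m, M.smul_mem (t : ℂ) hm, by rw [← smul_add]; exact smul_le_smul_of_nonneg_left h ht⟩

lemma LeMod.map {M : Submodule ℂ A} (hM : IsClosedTwoSidedIdeal M) {a b : A} (h : LeMod M b a)
    {Φ Ψ : A →L[ℂ] A} (hp : DualPair Φ Ψ) : LeMod M (Φ b) (Φ a) := by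
  obtain ⟨m, hm, h⟩ := h
  exact ⟨Φ m, hp.apply_mem hM.2 hm, by rw [← map_add]; exact hp.mono h⟩

lemma IsSelfAdjoint.le_norm_smul_one {h : A} (hh : IsSelfAdjoint h) : h ≤ ‖h‖ • (1 : A) := by
  simpa using isSelfAdjoint_le_norm hh

lemma IsSelfAdjoint.neg_le_of_norm_le {h : A} (hh : IsSelfAdjoint h) {c : ℝ} (hc : ‖h‖ ≤ c) :
    -(c • (1 : A)) ≤ h := by
  have h1 := hh.neg.le_norm_smul_one
  rw [norm_neg] at h1
  exact neg_le.1 (h1.trans (smul_le_smul_of_nonneg_right hc zero_le_one))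

end LeMod

section MainLemma

variable {X : Type*} [TopologicalSpace X] [CompactSpace X] {ι : C(X, ℂ) →⋆ₐ[ℂ] A}
  [PartialOrder A] [StarOrderedRing A] (H : IsDixmierModel ι) (x : X)
include H

lemma IsDixmierModel.exists_leMod_apply {c : A} (hc : IsSelfAdjoint c) {s : ℝ}
    (hs : s < upperVal ι x c) :
    ∃ T ∈ avgMaps (expMonoid A), LeMod (H.maxIdeal x) (s • (1 : A)) (T c) := by
  obtain ⟨g, hg, hgx⟩ := H.exists_lt_of_lt_upperVal x hs
  obtain ⟨T, hT, h⟩ := mem_centralValues_iff.1 hg _ (sub_pos.2 hgx)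
  have hgs := H.star_eq hc hg
  have him : (g x).im = 0 := by
    have := congrArg (fun f : C(X, ℂ) => (f x).im) hgs
    simp at this
    linarith
  have hgx' : g x = ((g x).re : ℂ) := Complex.ext rfl (by simpa using him)
  have h1 : IsSelfAdjoint (T c - ι g) := by
    rw [isSelfAdjoint_iff, star_sub, ← avgMaps_apply_star hT, hc.star_eq, ← map_star, hgs]
  refine ⟨T, hT, ι (g - algebraMap ℂ _ (g x)), H.map_mem_maxIdeal x (by simp), ?_⟩
  have h2 := h1.neg_le_of_norm_le h.le
  have h3 : ι (g - algebraMap ℂ _ (g x)) = ι g - (g x).re • (1 : A) := by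
    rw [map_sub, AlgHomClass.commutes, Algebra.algebraMap_eq_smul_one]
    conv_lhs => rw [hgx']
    rw [Complex.coe_smul]
  rw [h3]
  rw [neg_le_sub_iff_le_add] at h2
  calc s • (1 : A) + (ι g - (g x).re • 1) = ι g - ((g x).re - s) • (1 : A) := by module
    _ ≤ T c := by rw [sub_le_iff_le_add]; exact h2

lemma IsDixmierModel.exists_pair_one_leMod {c : A} (hc : IsSelfAdjoint c)
    (h : 0 < upperVal ι x c) :
    ∃ Φ Ψ : A →L[ℂ] A, DualPair Φ Ψ ∧ LeMod (H.maxIdeal x) 1 (Φ c) := by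
  obtain ⟨T, hT, h1⟩ := H.exists_leMod_apply x hc (half_lt_self h)
  obtain ⟨S, hS⟩ := DualPair.exists_of_avgMaps hT
  have h2 := h1.smul (t := (upperVal ι x c / 2)⁻¹) (by positivity)
  rw [smul_smul, inv_mul_cancel₀ (half_pos h).ne', one_smul] at h2
  exact ⟨_, _, hS.smul (by positivity), h2⟩

lemma IsDixmierModel.exists_pair_gap
    (hY : ¬ ∃ τ : A →L[ℂ] ℂ, IsTracialState τ ∧ ∀ m ∈ H.maxIdeal x, τ m = 0) :
    ∃ (Φ Ψ : A →L[ℂ] A) (c : ℝ), DualPair Φ Ψ ∧ 0 ≤ c ∧ Ψ 1 = c • (1 : A) ∧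
      LeMod (H.maxIdeal x) ((c + 1) • (1 : A)) (Φ 1) := by
  obtain ⟨v, hv, hv0⟩ := H.exists_upperVal_neg x hY
  obtain ⟨Ψ, Φ, h, rfl⟩ := DualPair.exists_of_mem_span hv
  have h1 : 0 < upperVal ι x (Φ 1 - Ψ 1) := by
    have := H.upperVal_add_le x (Ψ 1 - Φ 1) (Φ 1 - Ψ 1)
    rw [sub_add_sub_cancel, sub_self, H.upperVal_zero] at this
    linarith
  have sa : ∀ {Φ Ψ : A →L[ℂ] A}, DualPair Φ Ψ → IsSelfAdjoint (Φ 1) := fun {Φ Ψ} h =>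
    .of_nonneg (h.apply_nonneg zero_le_one)
  obtain ⟨s, hs0, hs1⟩ := exists_between h1
  obtain ⟨T, hT, m, hm, hle⟩ := H.exists_leMod_apply x ((sa h.symm).sub (sa h)) hs1
  obtain ⟨Φ', Ψ', h', e, e'⟩ := DualPair.exists_avgMaps_apply_one hT h.symm
  rw [map_sub, ← e, ← e'] at hle
  have hx0 : (0 : A) ≤ ‖Ψ' 1‖ • (1 : A) - Ψ' 1 := sub_nonneg.2 (sa h'.symm).le_norm_smul_one
  set y := CFC.sqrt (‖Ψ' 1‖ • (1 : A) - Ψ' 1) with hy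
  have hys : star y = y := (IsSelfAdjoint.of_nonneg (CFC.sqrt_nonneg _)).star_eq
  have hyy : y * y = ‖Ψ' 1‖ • (1 : A) - Ψ' 1 := CFC.sqrt_mul_sqrt_self _ hx0
  refine ⟨_, _, s⁻¹ * ‖Ψ' 1‖, (h'.add (.conj y)).smul (inv_nonneg.2 hs0.le), by positivity, ?_, ?_⟩
  · simp only [smul_apply, add_apply, conjL_apply, hys, mul_one, hyy, mul_smul, add_sub_cancel]
  · have : LeMod (H.maxIdeal x) ((s + ‖Ψ' 1‖) • (1 : A)) ((Φ' + conjL (star y)) 1) := by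
      refine ⟨m, hm, ?_⟩
      simp only [add_apply, conjL_apply, hys, mul_one, hyy]
      calc (s + ‖Ψ' 1‖) • (1 : A) + m = (s • 1 + m) + ‖Ψ' 1‖ • (1 : A) := by module
        _ ≤ (Φ' 1 - Ψ' 1) + ‖Ψ' 1‖ • (1 : A) := add_le_add_left hle _
        _ = _ := by abel
    have := this.smul (inv_nonneg.2 hs0.le)
    rwa [smul_smul, mul_add, inv_mul_cancel₀ hs0.ne', add_comm] at this

lemma IsDixmierModel.exists_pair_pow {Φ Ψ : A →L[ℂ] A} {c : ℝ} (h : DualPair Φ Ψ) (hc : 0 ≤ c)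
    (h1 : Ψ 1 = c • (1 : A)) (h2 : LeMod (H.maxIdeal x) ((c + 1) • (1 : A)) (Φ 1)) (n : ℕ) :
    ∃ Φ' Ψ' : A →L[ℂ] A, DualPair Φ' Ψ' ∧ Ψ' 1 = c ^ n • (1 : A) ∧
      LeMod (H.maxIdeal x) ((c + 1) ^ n • (1 : A)) (Φ' 1) := by
  induction n with
  | zero => exact ⟨_, _, .conj 1, by simp, 0, zero_mem _, by simp⟩
  | succ n ih =>
    obtain ⟨Φ', Ψ', h', e, e'⟩ := ih
    refine ⟨_, _, h'.comp h, ?_, ?_⟩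
    · rw [ContinuousLinearMap.comp_apply, h1]
      change Ψ' ((c : ℂ) • (1 : A)) = _
      rw [map_smul, e, Complex.coe_smul, smul_smul, pow_succ']
    · have h3 := e'.map (H.isClosedTwoSidedIdeal x) h
      refine LeMod.trans ?_ h3
      have h4 : Φ ((c + 1) ^ n • (1 : A)) = (c + 1) ^ n • Φ 1 := by
        change Φ ((((c + 1) ^ n : ℝ) : ℂ) • (1 : A)) = _
        rw [map_smul, Complex.coe_smul]
      rw [h4, pow_succ, mul_smul]
      exact h2.smul (by positivity)

lemma IsDixmierModel.exists_pair_small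
    (hY : ¬ ∃ τ : A →L[ℂ] ℂ, IsTracialState τ ∧ ∀ m ∈ H.maxIdeal x, τ m = 0) {e : A}
    (he : IsSelfAdjoint e) (he' : e ∉ H.maxIdeal x) {ε : ℝ} (hε : 0 < ε) :
    ∃ Φ Ψ : A →L[ℂ] A, DualPair Φ Ψ ∧ Ψ 1 ≤ ε • (1 : A) ∧ LeMod (H.maxIdeal x) 1 (Φ 1) ∧
      ∀ c, 0 ≤ e * c * e → 0 ≤ Φ c := by
  rw [H.mem_maxIdeal, he.star_eq, not_le] at he'
  have hee : IsSelfAdjoint (e * e) := by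
    simpa [he.star_eq] using IsSelfAdjoint.star_mul_self e
  obtain ⟨Φ₁, Ψ₁, h₁, l₁⟩ := H.exists_pair_one_leMod x hee he'
  obtain ⟨Φ₀, Ψ₀, c, h₀, hc, e₀, l₀⟩ := H.exists_pair_gap x hY
  have hlt : c / (c + 1) < 1 := (div_lt_one (by positivity)).2 (by linarith)
  obtain ⟨n, hn⟩ := exists_pow_lt_of_lt_one
    (show 0 < ε / (‖e * Ψ₁ 1 * e‖ + 1) by positivity) hlt
  obtain ⟨Φ₂, Ψ₂, h₂, e₂, l₂⟩ := H.exists_pair_pow x h₀ hc e₀ l₀ n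
  have h₃ := (((DualPair.conj e).comp h₁).comp h₂).smul
    (t := ((c + 1) ^ n)⁻¹) (by positivity)
  refine ⟨_, _, h₃, ?_, ?_, ?_⟩
  · have key : (((c + 1) ^ n)⁻¹ • ((conjL e).comp Ψ₁).comp Ψ₂) 1 =
        (c / (c + 1)) ^ n • (e * Ψ₁ 1 * e) := by
      have : Ψ₁ (c ^ n • (1 : A)) = c ^ n • Ψ₁ 1 := by
        change Ψ₁ (((c ^ n : ℝ) : ℂ) • (1 : A)) = _
        rw [map_smul, Complex.coe_smul]
      simp only [smul_apply, ContinuousLinearMap.comp_apply, e₂, this, conjL_apply, he.star_eq,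
        mul_smul_comm, smul_mul_assoc, smul_smul]
      rw [div_pow, div_eq_inv_mul]
    have hsa : IsSelfAdjoint (e * Ψ₁ 1 * e) := by
      have : 0 ≤ conjL e (Ψ₁ 1) :=
        (DualPair.conj e).symm.apply_nonneg (h₁.symm.apply_nonneg zero_le_one)
      rw [conjL_apply, he.star_eq] at this
      exact .of_nonneg this
    rw [key]
    refine (smul_le_smul_of_nonneg_left hsa.le_norm_smul_one (by positivity)).trans ?_
    rw [smul_smul]
    refine smul_le_smul_of_nonneg_right ?_ zero_le_one
    rw [lt_div_iff₀ (by positivity)] at hn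
    have : 0 ≤ (c / (c + 1)) ^ n := by positivity
    linarith
  · have l₃ := (l₁.map (H.isClosedTwoSidedIdeal x) h₂)
    have l₄ := (l₂.trans l₃).smul (t := ((c + 1) ^ n)⁻¹) (by positivity)
    have hcn : ((c + 1) ^ n : ℝ) ≠ 0 := by positivity
    rw [smul_smul, inv_mul_cancel₀ hcn, one_smul] at l₄
    simpa [he.star_eq] using l₄
  · intro c' hc'
    have hcn : (0 : ℝ) ≤ ((c + 1) ^ n)⁻¹ := by positivity
    rw [smul_apply]
    refine smul_nonneg hcn (h₂.apply_nonneg (h₁.apply_nonneg ?_))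
    simpa [he.star_eq] using hc'

lemma IsDixmierModel.mem_maxIdeal_of_cube {d : A} (hd : 0 ≤ d) (h : d * d * d ∈ H.maxIdeal x) :
    d ∈ H.maxIdeal x := by
  have hs := (IsSelfAdjoint.of_nonneg hd).star_eq
  have key : ∀ a : A, star a * a ∈ H.maxIdeal x → a ∈ H.maxIdeal x :=
    fun a ha => H.upperVal_nonpos_of_mem x ha
  refine key d (key _ ?_)
  have := ((H.isClosedTwoSidedIdeal x).2 d _ h).1
  simpa [hs, mul_assoc] using this

lemma IsDixmierModel.exists_pair_normalized
    (hY : ¬ ∃ τ : A →L[ℂ] ℂ, IsTracialState τ ∧ ∀ m ∈ H.maxIdeal x, τ m = 0) {e : A}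
    (he : IsSelfAdjoint e) (he' : e ∉ H.maxIdeal x) {ε : ℝ} (hε : 0 < ε) :
    ∃ Φ Ψ : A →L[ℂ] A, DualPair Φ Ψ ∧ Ψ 1 ≤ ε • (1 : A) ∧ 1 - Φ 1 ∈ H.maxIdeal x ∧
      ∀ c, 0 ≤ e * c * e → 0 ≤ Φ c := by
  obtain ⟨Φ, Ψ, hp, h1, ⟨m, hm, h2⟩, h3⟩ := H.exists_pair_small x hY he he' hε
  have hq : 0 ≤ Φ 1 := hp.apply_nonneg zero_le_one
  set q := Φ 1 with hqd
  have hqs : IsSelfAdjoint q := .of_nonneg hq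
  have hspec : ∀ r ∈ spectrum ℝ q, 0 ≤ r := fun r hr => spectrum_nonneg_of_nonneg hq hr
  have hpos : ∀ r : ℝ, 0 < max r 1 := fun r => lt_max_of_lt_right one_pos
  have hcont : Continuous fun r : ℝ => (√(max r 1))⁻¹ :=
    (Real.continuous_sqrt.comp (continuous_id.max continuous_const)).inv₀
      fun r => (Real.sqrt_pos.2 (hpos r)).ne'
  set g : A := cfc (fun r : ℝ => (√(max r 1))⁻¹) q with hg
  set d : A := cfc (fun r : ℝ => max (1 - r) 0) q with hd
  have hgs : star g = g := (cfc_predicate (fun r : ℝ => (√(max r 1))⁻¹) q : IsSelfAdjoint g).star_eq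
  have hsq : ∀ r : ℝ, √(max r 1) * √(max r 1) = max r 1 := fun r =>
    Real.mul_self_sqrt (hpos r).le
  have hgg : g * g ≤ 1 := by
    rw [hg, ← cfc_mul (fun r : ℝ => (√(max r 1))⁻¹) (fun r : ℝ => (√(max r 1))⁻¹) q
      hcont.continuousOn hcont.continuousOn]
    refine cfc_le_one _ _ fun r hr => ?_
    rw [← mul_inv, hsq]
    exact inv_le_one_of_one_le₀ (le_max_right _ _)
  have hgq : g * q * g = 1 - d := by
    have e1 : g * q = cfc (fun r : ℝ => (√(max r 1))⁻¹ * r) q := by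
      rw [cfc_mul (fun r : ℝ => (√(max r 1))⁻¹) (fun r : ℝ => r) q hcont.continuousOn, cfc_id' ℝ q]
    rw [e1, hg, ← cfc_mul (fun r : ℝ => (√(max r 1))⁻¹ * r) (fun r : ℝ => (√(max r 1))⁻¹) q
      (hcont.mul continuous_id).continuousOn hcont.continuousOn, hd, ← cfc_const_one ℝ q,
      ← cfc_sub (fun _ => 1) (fun r : ℝ => max (1 - r) 0) q]
    refine cfc_congr fun r hr => ?_
    have h4 := hspec r hr
    have h5 : (√(max r 1))⁻¹ * r * (√(max r 1))⁻¹ = (max r 1)⁻¹ * r := by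
      have h6 := congrArg (·⁻¹) (hsq r)
      simp only [mul_inv] at h6
      rw [← h6]; ring
    simp only [h5]
    rcases le_total r 1 with h | h
    · rw [max_eq_right h, max_eq_left (by linarith)]; ring
    · rw [max_eq_left h, max_eq_right (by linarith), inv_mul_cancel₀ (by linarith)]; ring
  have hd0 : 0 ≤ d := cfc_nonneg fun r _ => le_max_right _ _
  have hds := IsSelfAdjoint.of_nonneg hd0
  have hdq : d * (1 - q) * d = d * d * d := by
    have e0 : cfc (fun r : ℝ => 1 - r) q = 1 - q := by
      rw [cfc_sub (fun _ => 1) (fun r : ℝ => r) q, cfc_const_one ℝ q, cfc_id' ℝ q]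
    rw [← e0, hd, ← cfc_mul (fun r : ℝ => max (1 - r) 0) (fun r => 1 - r) q,
      ← cfc_mul (fun r : ℝ => max (1 - r) 0) (fun r : ℝ => max (1 - r) 0) q]
    congr 1
    refine cfc_congr fun r hr => ?_
    rcases le_total r 1 with h | h
    · rw [max_eq_left (by linarith)]
    · rw [max_eq_right (by linarith)]; ring
  have hdM : d ∈ H.maxIdeal x := by
    refine H.mem_maxIdeal_of_cube x hd0 (H.mem_maxIdeal_of_nonneg x ?_ ?_)
    · rw [mul_assoc]
      simpa [hds.star_eq, mul_assoc] using star_left_conjugate_nonneg hd0 d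
    · have h4 : 1 - q ≤ -m := by
        rw [sub_le_iff_le_add, neg_add_eq_sub, le_sub_iff_add_le]; exact h2
      have h5 := star_left_conjugate_le_conjugate h4 d
      rw [hds.star_eq, hdq] at h5
      refine (H.upperVal_mono x h5).trans (H.upperVal_nonpos_of_mem x ?_)
      have hI := (H.isClosedTwoSidedIdeal x).2
      exact (hI _ _ (hI _ _ (neg_mem hm)).1).2
  have hpg : DualPair (conjL g) (conjL g) := by simpa [hgs] using DualPair.conj g
  refine ⟨_, _, hp.comp hpg, ?_, ?_, fun c hc => ?_⟩
  · rw [ContinuousLinearMap.comp_apply]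
    refine (hp.symm.mono ?_).trans h1
    simpa [hgs] using hgg
  · rw [ContinuousLinearMap.comp_apply, conjL_apply, hgs, ← hqd, hgq, sub_sub_cancel]
    exact hdM
  · exact hpg.apply_nonneg (h3 c hc)

/-- If no tracial state vanishes on `M`, a self-adjoint element whose positive part is not in `M`
has nonnegative upper value. -/
lemma IsDixmierModel.upperVal_nonneg_of_notMem
    (hY : ¬ ∃ τ : A →L[ℂ] ℂ, IsTracialState τ ∧ ∀ m ∈ H.maxIdeal x, τ m = 0) {h : A}
    (hh : IsSelfAdjoint h) (hM : h⁺ ∉ H.maxIdeal x) : 0 ≤ upperVal ι x h := by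
  have he : IsSelfAdjoint h⁺ := .of_nonneg (CFC.posPart_nonneg h)
  have hhe : 0 ≤ h⁺ * h * h⁺ := by
    have e1 : h⁺ * h = h⁺ * h⁺ := by
      have e2 := CFC.posPart_sub_negPart h hh
      calc h⁺ * h = h⁺ * (h⁺ - h⁻) := by rw [e2]
        _ = h⁺ * h⁺ := by rw [mul_sub, CFC.posPart_mul_negPart, sub_zero]
    rw [e1]
    simpa [he.star_eq] using star_left_conjugate_nonneg (CFC.posPart_nonneg h) h⁺
  suffices key : ∀ ε > 0, -(2 * ε * ‖h‖) ≤ upperVal ι x h by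
    refine le_of_forall_pos_le_add fun δ hδ => ?_
    have h1 := key (δ / (2 * (‖h‖ + 1))) (by positivity)
    have h2 : 2 * (δ / (2 * (‖h‖ + 1))) * ‖h‖ ≤ δ := by
      rw [mul_div_assoc', mul_div_mul_left _ _ two_ne_zero, div_mul_eq_mul_div,
        div_le_iff₀ (by positivity)]
      nlinarith
    linarith
  intro ε hε
  obtain ⟨Φ, Ψ, hp, h1, h2, h3⟩ := H.exists_pair_normalized x hY he hM hε
  obtain ⟨C, t₀, ht₀, ht⟩ := hp.isTangent h
  set d := 1 - Φ 1 with hd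
  set b := Ψ 1 with hb
  have hb0 : 0 ≤ b := hp.symm.apply_nonneg zero_le_one
  have hbs : IsSelfAdjoint b := .of_nonneg hb0
  have hbn : ‖b‖ ≤ ε := by
    have := CStarAlgebra.norm_le_norm_of_nonneg_of_le hb0 h1
    rcases subsingleton_or_nontrivial A with _ | _
    · simp [Subsingleton.elim b 0, hε.le]
    · simpa [norm_smul, abs_of_pos hε] using this
  have hΨh : -((ε * ‖h‖) • (1 : A)) ≤ Ψ h := by
    have h4 := hp.symm.mono (hh.neg_le_of_norm_le le_rfl)
    have h5 : Ψ (-(‖h‖ • (1 : A))) = -(‖h‖ • b) := by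
      change Ψ (-(((‖h‖ : ℝ) : ℂ) • (1 : A))) = _
      rw [map_neg, map_smul, Complex.coe_smul]
    rw [h5] at h4
    refine le_trans (neg_le_neg ?_) h4
    rw [mul_comm, mul_smul]
    exact smul_le_smul_of_nonneg_left h1 (norm_nonneg h)
  have hbh : b * h + h * b ≤ (2 * ε * ‖h‖) • (1 : A) := by
    have h4 : IsSelfAdjoint (b * h + h * b) := by
      rw [isSelfAdjoint_iff, star_add, star_mul, star_mul, hbs.star_eq, hh.star_eq, add_comm]
    refine h4.le_norm_smul_one.trans (smul_le_smul_of_nonneg_right ?_ zero_le_one)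
    have h5 := norm_mul_le_of_le hbn (le_refl ‖h‖)
    have h6 := norm_mul_le_of_le (le_refl ‖h‖) hbn
    linarith [norm_add_le (b * h) (h * b)]
  have hL : -h + (1 / 2 : ℝ) • (d * h + h * d) - (2 * ε * ‖h‖) • (1 : A) ≤
      Φ h + Ψ h - (1 / 2 : ℝ) • ((Φ 1 + b) * h + h * (Φ 1 + b)) := by
    have e : Φ h + Ψ h - (1 / 2 : ℝ) • ((Φ 1 + b) * h + h * (Φ 1 + b)) =
        -h + (1 / 2 : ℝ) • (d * h + h * d) +
          (Φ h + Ψ h + -((1 / 2 : ℝ) • (b * h + h * b))) := by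
      rw [hd]
      simp only [add_mul, mul_add, sub_mul, mul_sub, one_mul, mul_one]
      module
    rw [e, sub_eq_add_neg]
    refine add_le_add_right ?_ _
    calc -((2 * ε * ‖h‖) • (1 : A)) = 0 + -((ε * ‖h‖) • (1 : A)) +
          -((1 / 2 : ℝ) • ((2 * ε * ‖h‖) • (1 : A))) := by module
      _ ≤ _ := add_le_add (add_le_add (h3 h hhe) hΨh)
          (neg_le_neg (smul_le_smul_of_nonneg_left hbh (by norm_num)))
  set L := Φ h + Ψ h - (1 / 2 : ℝ) • ((Φ 1 + b) * h + h * (Φ 1 + b)) with hLd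
  set m := (1 / 2 : ℝ) • (d * h + h * d) with hm
  have hmM : ∀ t : ℝ, t • m ∈ H.maxIdeal x := fun t => by
    have hI := (H.isClosedTwoSidedIdeal x).2
    exact Submodule.smul_mem _ (t : ℂ) (Submodule.smul_mem _ (((1 / 2 : ℝ)) : ℂ)
      (add_mem (hI _ _ h2).2 (hI _ _ h2).1))
  have hLs : IsSelfAdjoint L := by
    have e1 := hp.apply_star h
    have e2 := hp.symm.apply_star h
    have e3 := hp.apply_star 1
    rw [hh.star_eq] at e1 e2
    rw [star_one] at e3
    rw [isSelfAdjoint_iff, hLd]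
    simp only [star_sub, star_add, star_smul, star_mul, ← e1, ← e2, ← e3, hbs.star_eq, hh.star_eq,
      star_trivial]
    rw [add_comm (h * _)]
  refine le_of_forall_pos_le_add fun δ hδ => ?_
  obtain ⟨t, ht0, ht1, ht2, ht3⟩ : ∃ t, 0 < t ∧ t ≤ t₀ ∧ t < 1 ∧ C * t ≤ δ := by
    refine ⟨min (min t₀ (1 / 2)) (δ / (|C| + 1)), by positivity, ?_, ?_, ?_⟩
    · exact (min_le_left _ _).trans (min_le_left _ _)
    · exact ((min_le_left _ _).trans (min_le_right _ _)).trans_lt (by norm_num)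
    · have h4 := min_le_right (min t₀ (1 / 2)) (δ / (|C| + 1))
      rw [le_div_iff₀ (by positivity)] at h4
      have h5 : 0 < min (min t₀ (1 / 2)) (δ / (|C| + 1)) := by positivity
      nlinarith [le_abs_self C]
  obtain ⟨T, hT, hTn⟩ := ht t ht0.le ht1
  have hTs : IsSelfAdjoint (T h - h - t • L) := by
    refine (IsSelfAdjoint.sub ?_ hh).sub ((IsSelfAdjoint.all t).smul hLs)
    rw [isSelfAdjoint_iff, ← avgMaps_apply_star hT, hh.star_eq]
  have h4 := hTs.neg_le_of_norm_le hTn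
  have h5 : (((1 - t : ℝ) : ℂ) • h) ≤
      T h + ((((t * (2 * ε * ‖h‖) + C * t ^ 2 : ℝ) : ℂ) • (1 : A)) + (-t) • m) := by
    have h6 := smul_le_smul_of_nonneg_left hL ht0.le
    have h7 := add_le_add h4 h6
    rw [sub_add_cancel] at h7
    rw [Complex.coe_smul, Complex.coe_smul, ← sub_nonneg]
    rw [← sub_nonneg] at h7
    convert h7 using 1
    module
  have h6 := H.upperVal_mono x h5
  rw [H.upperVal_smul x (by linarith)] at h6
  have h7 := H.upperVal_add_le x (T h)
    ((((t * (2 * ε * ‖h‖) + C * t ^ 2 : ℝ) : ℂ) • (1 : A)) + (-t) • m)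
  have h8 := H.upperVal_add_le x (((t * (2 * ε * ‖h‖) + C * t ^ 2 : ℝ) : ℂ) • (1 : A)) ((-t) • m)
  rw [H.upperVal_algebraMap] at h8
  have h9 := H.upperVal_nonpos_of_mem x (hmM (-t))
  have h10 := H.upperVal_apply_le x hT h
  have h11 : t * -(2 * ε * ‖h‖) ≤ t * (upperVal ι x h + C * t) := by nlinarith
  linarith [le_of_mul_le_mul_left h11 ht0]

end MainLemma

section PointwiseBound

variable {X : Type*} [TopologicalSpace X] [CompactSpace X] {ι : C(X, ℂ) →⋆ₐ[ℂ] A}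

lemma IsDixmierModel.convex_centralValues (H : IsDixmierModel ι) (a : A) :
    Convex ℝ (centralValues ι a) := by
  intro g hg g' hg' s t hs ht hst
  have h := H.glue (f := ContinuousMap.const X s) hg hg' (fun _ => hs)
    (fun _ => by simpa using by linarith)
  convert h using 1
  obtain rfl : t = 1 - s := by linarith
  ext y
  simp [toC_apply]

variable [PartialOrder A] [StarOrderedRing A] (H : IsDixmierModel ι) (x : X)
include H

lemma IsDixmierModel.upperVal_realPart_le (a : A) :
    upperVal ι x (((2⁻¹ : ℝ) : ℂ) • (a + star a)) ≤ upperVal ι x a := by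
  have hk : IsSelfAdjoint (((2⁻¹ : ℝ) : ℂ) • (Complex.I • (a - star a))) := by
    rw [isSelfAdjoint_iff, star_smul, star_smul, star_sub, star_star, RCLike.star_def,
      Complex.conj_ofReal, Complex.conj_I, neg_smul, ← smul_neg, neg_sub]
  have h1 : ((2⁻¹ : ℝ) : ℂ) • (a + star a) =
      a + Complex.I • (((2⁻¹ : ℝ) : ℂ) • (Complex.I • (a - star a))) := by
    rw [smul_comm Complex.I, smul_smul Complex.I, Complex.I_mul_I]
    match_scalars <;> norm_num
  rw [h1]
  linarith [H.upperVal_add_le x a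
    (Complex.I • (((2⁻¹ : ℝ) : ℂ) • (Complex.I • (a - star a)))), H.upperVal_I_smul x hk]

/-- If no tracial state vanishes on the maximal ideal at `x`, all states vanishing on this ideal
are dominated by the upper value functional. -/
lemma IsDixmierModel.re_apply_le_upperVal
    (hY : ¬ ∃ τ : A →L[ℂ] ℂ, IsTracialState τ ∧ ∀ m ∈ H.maxIdeal x, τ m = 0)
    {ρ : A →L[ℂ] ℂ} (hρ : IsState ρ) (hM : ∀ m ∈ H.maxIdeal x, ρ m = 0) (a : A) :
    (ρ a).re ≤ upperVal ι x a := by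
  have key : ∀ h : A, IsSelfAdjoint h → (ρ h).re ≤ upperVal ι x h := fun h hh => by
    by_contra! hlt
    obtain ⟨s, hs, hs'⟩ := exists_between hlt
    set k := h + (((-s : ℝ) : ℂ) • (1 : A)) with hk
    have hks : IsSelfAdjoint k := hh.add (by
      rw [isSelfAdjoint_iff, star_smul, star_one, RCLike.star_def, Complex.conj_ofReal])
    have h1 := H.upperVal_add_le x h (((-s : ℝ) : ℂ) • (1 : A))
    rw [H.upperVal_algebraMap, ← hk] at h1
    have h2 : k⁺ ∈ H.maxIdeal x := by
      by_contra h2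
      linarith [H.upperVal_nonneg_of_notMem x hY hks h2]
    have h3 : ρ k = ρ h - s := by
      rw [hk, map_add, map_smul, hρ.map_one]
      simp [sub_eq_add_neg]
    have h4 : ρ k = -ρ k⁻ := by
      conv_lhs => rw [← CFC.posPart_sub_negPart k hks]
      rw [map_sub, hM _ h2, zero_sub]
    have h5 := positive_apply_nonneg hρ.2 (CFC.negPart_nonneg k)
    have h6 := congrArg Complex.re (h3.symm.trans h4)
    simp only [Complex.sub_re, Complex.ofReal_re, Complex.neg_re] at h6
    linarith [(Complex.nonneg_iff.1 h5).1]
  refine le_trans (le_of_eq ?_) ((key _ ?_).trans (H.upperVal_realPart_le x a))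
  · rw [map_smul, map_add, positive_apply_star hρ.2]
    simp
    ring
  · rw [isSelfAdjoint_iff, star_smul, star_add, star_star, add_comm, RCLike.star_def,
      Complex.conj_ofReal]

lemma IsDixmierModel.exists_apply_near {a : A} {c : ℂ} (hc : c ∈ dixmierF (H.maxIdeal x) a)
    {ε : ℝ} (hε : 0 < ε) : ∃ g ∈ centralValues ι a, dist (g x) c < ε := by
  by_cases hY : ∃ τ : A →L[ℂ] ℂ, IsTracialState τ ∧ ∀ m ∈ H.maxIdeal x, τ m = 0
  · simp only [dixmierF, if_pos hY] at hc
    obtain ⟨τ, hτ, hM, rfl⟩ := hc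
    obtain ⟨g, hg⟩ := H.nonempty a
    refine ⟨g, hg, ?_⟩
    suffices h : g x = τ a by simpa [h] using hε
    have h1 : τ (ι g) = g x := by
      have := hM _ (H.map_mem_maxIdeal x (g := g - algebraMap ℂ _ (g x)) (by simp))
      rw [map_sub, AlgHomClass.commutes, Algebra.algebraMap_eq_smul_one, map_sub, map_smul,
        hτ.isState.map_one, sub_eq_zero] at this
      simpa using this
    rw [← h1, ← sub_eq_zero, ← norm_eq_zero]
    refine le_antisymm (le_of_forall_pos_le_add fun δ hδ => ?_) (norm_nonneg _)
    obtain ⟨T, hT, h2⟩ := mem_centralValues_iff.1 hg δ hδ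
    rw [← hτ.apply_avgMaps (avgMaps_mono expMonoid_le_unitary hT) a, ← map_sub, ← norm_neg,
      ← map_neg, neg_sub, zero_add]
    exact (hτ.isState.norm_le _).trans h2.le
  · simp only [dixmierF, if_neg hY] at hc
    obtain ⟨ρ, hρ, hM, rfl⟩ := hc
    set S : Set ℂ := (fun g : C(X, ℂ) => g x) '' centralValues ι a with hS
    suffices h : ρ a ∈ closure S by
      obtain ⟨_, ⟨g, hg, rfl⟩, h⟩ := Metric.mem_closure_iff.1 h ε hε
      exact ⟨g, hg, by rwa [dist_comm]⟩
    by_contra hn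
    have hconv : Convex ℝ S :=
      (H.convex_centralValues a).is_linear_image ⟨fun _ _ => rfl, fun _ _ => rfl⟩
    obtain ⟨f, u, h1, h2⟩ := RCLike.geometric_hahn_banach_closed_point (𝕜 := ℂ)
      hconv.closure isClosed_closure hn
    have hf : ∀ z, f z = f 1 * z := fun z => by
      have := map_smul f z 1
      rwa [smul_eq_mul, smul_eq_mul, mul_one, mul_comm] at this
    have hS1 : ∀ g ∈ centralValues ι a, (f 1 * g x).re < u := fun g hg => by
      rw [← hf]; exact h1 _ (subset_closure ⟨g, hg, rfl⟩)
    have h3 : (ρ (f 1 • a)).re ≤ u := by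
      refine (H.re_apply_le_upperVal x hY hρ hM _).trans (H.upperVal_le x fun g hg => ?_)
      by_cases h0 : f 1 = 0
      · obtain ⟨g', hg'⟩ := H.nonempty a
        have := hS1 g' hg'
        have e : g = 0 := H.eq_of_mem (by simpa [h0] using hg)
        simp only [h0, zero_mul] at this
        simpa [e] using this.le
      · have := hS1 _ (by simpa [smul_smul, h0] using smul_mem_centralValues hg (f 1)⁻¹)
        simpa [h0] using this.le
    rw [map_smul, smul_eq_mul, ← hf] at h3
    exact absurd h2 h3.not_gt

lemma IsDixmierModel.dixmierF_nonempty (a : A) : (dixmierF (H.maxIdeal x) a).Nonempty := by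
  by_cases hY : ∃ τ : A →L[ℂ] ℂ, IsTracialState τ ∧ ∀ m ∈ H.maxIdeal x, τ m = 0
  · simp only [dixmierF, if_pos hY]
    obtain ⟨τ, h1, h2⟩ := hY
    exact ⟨_, τ, h1, h2, rfl⟩
  · simp only [dixmierF, if_neg hY]
    obtain ⟨ρ, h1, h2, -⟩ := H.exists_state x ⊥ (by simp [H.upperVal_zero])
    exact ⟨_, ρ, h1, h2, rfl⟩

lemma IsDixmierModel.exists_apply_sub_lt (a b : A) {r : ℝ}
    (hr : setDist (dixmierF (H.maxIdeal x) a) (dixmierF (H.maxIdeal x) b) < r) :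
    ∃ g ∈ centralValues ι a, ∃ h ∈ centralValues ι b, ‖g x - h x‖ < r := by
  obtain ⟨c, hc, d, hd, hcd⟩ :=
    exists_dist_lt_of_setDist_lt (H.dixmierF_nonempty x a) (H.dixmierF_nonempty x b) hr
  have hε : 0 < (r - dist c d) / 2 := by linarith
  obtain ⟨g, hg, h1⟩ := H.exists_apply_near x hc hε
  obtain ⟨h, hh, h2⟩ := H.exists_apply_near x hd hε
  refine ⟨g, hg, h, hh, ?_⟩
  rw [← dist_eq_norm]
  linarith [dist_triangle4_right (g x) (h x) c d]

end PointwiseBound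

/-! ### Selections in sets of continuous functions -/

section Selection

lemma exists_le_zero_of_forall_step {α : Type*} [MetricSpace α] [CompleteSpace α] {E : Set α}
    (hE : IsClosed E) {f : α → ℝ} (hf : Continuous f) (h0 : ∃ z ∈ E, f z ≤ 1)
    (hstep : ∀ n : ℕ, ∀ z ∈ E, f z ≤ (1 / 4) ^ n →
      ∃ z' ∈ E, f z' ≤ (1 / 4) ^ (n + 1) ∧ dist z z' ≤ (1 / 2) ^ n) :
    ∃ z ∈ E, f z ≤ 0 := by
  obtain ⟨z₀, hz₀, h0⟩ := h0
  choose! F hF1 hF2 hF3 using hstep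
  let u : ℕ → α := fun n => n.rec z₀ F
  have hu : ∀ n, u n ∈ E ∧ f (u n) ≤ (1 / 4) ^ n := fun n => by
    induction n with
    | zero => exact ⟨hz₀, by rw [pow_zero]; exact h0⟩
    | succ n ih => exact ⟨hF1 n _ ih.1 ih.2, hF2 n _ ih.1 ih.2⟩
  have hc : CauchySeq u := cauchySeq_of_le_geometric (1 / 2) 1 (by norm_num) fun n => by
    rw [one_mul]; exact hF3 n _ (hu n).1 (hu n).2
  obtain ⟨z, hz⟩ := cauchySeq_tendsto_of_complete hc
  refine ⟨z, hE.mem_of_tendsto hz (.of_forall fun n => (hu n).1), ?_⟩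
  exact le_of_tendsto_of_tendsto' ((hf.tendsto z).comp hz)
    (tendsto_pow_atTop_nhds_zero_of_lt_one (by norm_num) (by norm_num)) fun n => (hu n).2

variable {X : Type*} [TopologicalSpace X]

/-- A set of functions is stable under gluing along continuous functions with values in the unit
interval. -/
def IsGluingStable (E : Set C(X, ℂ)) : Prop :=
  ∀ g ∈ E, ∀ g' ∈ E, ∀ f : C(X, ℝ), (∀ x, 0 ≤ f x) → (∀ x, f x ≤ 1) →
    toC f * g + (1 - toC f) * g' ∈ E

lemma norm_glue_apply_le {f : C(X, ℝ)} {x : X} (h0 : 0 ≤ f x) (h1 : f x ≤ 1) (g g' : C(X, ℂ)) :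
    ‖(toC f * g + (1 - toC f) * g') x‖ ≤ f x * ‖g x‖ + (1 - f x) * ‖g' x‖ := by
  have e : (toC f * g + (1 - toC f) * g') x =
      ((f x : ℝ) : ℂ) * g x + ((1 - f x : ℝ) : ℂ) * g' x := by
    simp
  rw [e]
  refine (norm_add_le _ _).trans_eq ?_
  rw [norm_mul, norm_mul, Complex.norm_of_nonneg h0, Complex.norm_of_nonneg (by linarith)]

/-- A gluing of `d` and `d'` which is small wherever one of them is small. -/
lemma exists_glue_le [CompactSpace X] {D : Set C(X, ℂ)} (hD : IsGluingStable D) {d d' : C(X, ℂ)}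
    (hd : d ∈ D) (hd' : d' ∈ D) {s t : ℝ} (hts : t < s) :
    ∃ e ∈ D, ∀ y, ‖d y‖ ≤ t ∨ ‖d' y‖ ≤ t → ‖e y‖ ≤ (s + t) / 2 := by
  have hst : 0 < 2 * (s - t) := by linarith
  let f : C(X, ℝ) :=
    ⟨fun y => max 0 (min 1 (1 / 2 + (‖d' y‖ - ‖d y‖) / (2 * (s - t)))), by fun_prop⟩
  have hf : ∀ y, f y = max 0 (min 1 (1 / 2 + (‖d' y‖ - ‖d y‖) / (2 * (s - t)))) := fun _ => rfl
  have h0 : ∀ y, 0 ≤ f y := fun y => le_max_left _ _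
  have h1 : ∀ y, f y ≤ 1 := fun y => max_le zero_le_one (min_le_left _ _)
  refine ⟨_, hD d hd d' hd' f h0 h1, fun y hy => (norm_glue_apply_le (h0 y) (h1 y) d d').trans ?_⟩
  rw [hf]
  set a := ‖d y‖
  set b := ‖d' y‖
  set q := (b - a) / (2 * (s - t)) with hq
  have hq' : q * (2 * (s - t)) = b - a := div_mul_cancel₀ _ hst.ne'
  rcases le_total 1 (1 / 2 + q) with h | h
  · rw [min_eq_left h, max_eq_right zero_le_one]
    rcases hy with hy | hy <;> nlinarith
  rw [min_eq_right h]
  rcases le_total 0 (1 / 2 + q) with h' | h'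
  · rw [max_eq_right h']
    have hb : b = a + q * (2 * (s - t)) := by linarith
    rcases hy with hy | hy
    · rw [hb]
      nlinarith [mul_nonneg (sub_pos.2 hts).le (sq_nonneg (4 * q - 1))]
    · rw [hb] at hy ⊢
      nlinarith [mul_nonneg (sub_pos.2 hts).le (sq_nonneg (4 * q + 1))]
  · rw [max_eq_left h']
    rcases hy with hy | hy <;> nlinarith

lemma IsGluingStable.exists_norm_apply_lt [CompactSpace X] {D : Set C(X, ℂ)}
    (hD : IsGluingStable D) (hne : D.Nonempty) {s : ℝ} (h : ∀ x, ∃ d ∈ D, ‖d x‖ < s) :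
    ∃ d ∈ D, ∀ x, ‖d x‖ < s := by
  suffices key : ∃ d ∈ D, ∃ t < s, ∀ y ∈ (Set.univ : Set X), ‖d y‖ ≤ t by
    obtain ⟨d, hd, t, ht, hdt⟩ := key
    exact ⟨d, hd, fun x => (hdt x trivial).trans_lt ht⟩
  refine isCompact_univ.induction_on (p := fun K => ∃ d ∈ D, ∃ t < s, ∀ y ∈ K, ‖d y‖ ≤ t)
    ?_ ?_ ?_ ?_
  · obtain ⟨d, hd⟩ := hne
    exact ⟨d, hd, s - 1, by linarith, by simp⟩
  · rintro K L hKL ⟨d, hd, t, ht, hdt⟩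
    exact ⟨d, hd, t, ht, fun y hy => hdt y (hKL hy)⟩
  · rintro K L ⟨d, hd, t, ht, hdt⟩ ⟨d', hd', t', ht', hdt'⟩
    obtain ⟨e, he, h2⟩ := exists_glue_le hD hd hd' (max_lt ht ht')
    refine ⟨e, he, _, by linarith [max_lt ht ht'], fun y hy => h2 y ?_⟩
    exact hy.imp (fun hy => (hdt y hy).trans (le_max_left _ _))
      fun hy => (hdt' y hy).trans (le_max_right _ _)
  · intro x _
    obtain ⟨d, hd, hdx⟩ := h x
    obtain ⟨t, ht, ht'⟩ := exists_between hdx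
    refine ⟨{y | ‖d y‖ < t}, mem_nhdsWithin_of_mem_nhds ?_, d, hd, t, ht', fun y hy => hy.le⟩
    exact (isOpen_lt (by fun_prop) continuous_const).mem_nhds ht

lemma IsGluingStable.exists_norm_sub_apply_lt [CompactSpace X] {E F : Set C(X, ℂ)}
    (hE : IsGluingStable E) (hF : IsGluingStable F) (hEne : E.Nonempty) (hFne : F.Nonempty)
    {s : ℝ} (h : ∀ x, ∃ g ∈ E, ∃ g' ∈ F, ‖g x - g' x‖ < s) :
    ∃ g ∈ E, ∃ g' ∈ F, ∀ x, ‖g x - g' x‖ < s := by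
  have hD : IsGluingStable (Set.image2 (fun g g' => g - g') E F) := by
    rintro _ ⟨g, hg, h, hh, rfl⟩ _ ⟨g', hg', h', hh', rfl⟩ f h0 h1
    exact ⟨_, hE g hg g' hg' f h0 h1, _, hF h hh h' hh' f h0 h1, by ring⟩
  obtain ⟨_, ⟨g, hg, g', hg', rfl⟩, h⟩ := hD.exists_norm_apply_lt (hEne.image2 hFne) fun x => by
    obtain ⟨g, hg, g', hg', hx⟩ := h x
    exact ⟨_, ⟨g, hg, g', hg', rfl⟩, hx⟩
  exact ⟨g, hg, g', hg', h⟩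

/-- Moving `z` towards `w` decreases the excess of `‖z‖ ^ 2` over `R` in a controlled manner. -/
lemma exists_glue_norm_sq_le [CompactSpace X] {E : Set C(X, ℂ)} (hE : IsGluingStable E)
    {z w : C(X, ℂ)} (hz : z ∈ E) (hw : w ∈ E) {R α β : ℝ} (hβ : 0 < β) (hα : 0 ≤ α)
    (hzR : ∀ x, ‖z x‖ ^ 2 ≤ R + α) (hwR : ∀ x, ‖w x‖ ^ 2 ≤ R + β / 2) :
    ∃ z' ∈ E, (∀ x, ‖z' x‖ ^ 2 ≤ R + β) ∧ ∀ x, ‖z x - z' x‖ ^ 2 ≤ α := by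
  let N : X → ℝ := fun x => max (max (max 0 (‖z x‖ ^ 2 - R - β / 2)) (‖w x - z x‖ ^ 2)) (β / 2)
  have hN : ∀ x, 0 < N x := fun x => lt_max_of_lt_right (half_pos hβ)
  let f : C(X, ℝ) := ⟨fun x => max 0 (‖z x‖ ^ 2 - R - β / 2) / N x,
    Continuous.div (by fun_prop) (by fun_prop) fun x => (hN x).ne'⟩
  have hfN : ∀ x, f x * N x = max 0 (‖z x‖ ^ 2 - R - β / 2) := fun x =>
    div_mul_cancel₀ _ (hN x).ne'
  have h0 : ∀ x, 0 ≤ f x := fun x => div_nonneg (le_max_left _ _) (hN x).le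
  have h1 : ∀ x, f x ≤ 1 := fun x => (div_le_one (hN x)).2
    ((le_max_left _ _).trans (le_max_left _ _))
  have hk : ∀ x, f x * ‖w x - z x‖ ^ 2 ≤ max 0 (‖z x‖ ^ 2 - R - β / 2) := fun x => by
    rw [← hfN]
    exact mul_le_mul_of_nonneg_left ((le_max_right _ _).trans (le_max_left _ _)) (h0 x)
  refine ⟨_, hE w hw z hz f h0 h1, fun x => ?_, fun x => ?_⟩
  · have e : ‖(toC f * w + (1 - toC f) * z) x‖ ^ 2 =
        ‖z x‖ ^ 2 - f x * (‖z x‖ ^ 2 - ‖w x‖ ^ 2) - f x * (1 - f x) * ‖w x - z x‖ ^ 2 := by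
      rw [← Complex.normSq_eq_norm_sq, ← Complex.normSq_eq_norm_sq, ← Complex.normSq_eq_norm_sq,
        ← Complex.normSq_eq_norm_sq]
      simp [Complex.normSq_apply]
      ring
    rw [e]
    have h2 := hfN x
    have h3 := h0 x
    have h4 := h1 x
    have h5 := hwR x
    suffices h : (1 - f x) * ((‖z x‖ ^ 2 - R - β / 2) - f x * ‖w x - z x‖ ^ 2) ≤ β / 2 by
      nlinarith
    have h6 : (1 - f x) * ((‖z x‖ ^ 2 - R - β / 2) - f x * ‖w x - z x‖ ^ 2) ≤
        (1 - f x) * (f x * N x - f x * ‖w x - z x‖ ^ 2) := by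
      rw [h2]
      gcongr
      exact le_max_right _ _
    refine h6.trans ?_
    rcases max_choice (max (max 0 (‖z x‖ ^ 2 - R - β / 2)) (‖w x - z x‖ ^ 2)) (β / 2) with h | h
    · rcases max_choice (max 0 (‖z x‖ ^ 2 - R - β / 2)) (‖w x - z x‖ ^ 2) with h' | h'
      · have h7 : N x = max 0 (‖z x‖ ^ 2 - R - β / 2) := h.trans h'
        have h8 : f x = 1 := by
          refine mul_right_cancel₀ (hN x).ne' ?_
          rw [h2, h7, one_mul]
        rw [h8, sub_self, zero_mul]
        positivity
      · have h7 : N x = ‖w x - z x‖ ^ 2 := h.trans h'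
        rw [h7, sub_self, mul_zero]
        positivity
    · have h7 : N x = β / 2 := h
      rw [h7]
      nlinarith [mul_nonneg h3 (sq_nonneg ‖w x - z x‖), mul_nonneg (sub_nonneg.2 h4)
        (mul_nonneg h3 (sq_nonneg ‖w x - z x‖)), mul_nonneg (sub_nonneg.2 h4) (sub_nonneg.2 h4)]
  · have e : z x - (toC f * w + (1 - toC f) * z) x = -((f x : ℂ) * (w x - z x)) := by
      simp; ring
    rw [e, norm_neg, norm_mul, Complex.norm_of_nonneg (h0 x), mul_pow]
    have h2 := hk x
    have h3 := h0 x
    have h4 := h1 x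
    have h5 : max 0 (‖z x‖ ^ 2 - R - β / 2) ≤ α := max_le hα (by linarith [hzR x])
    have h6 : 0 ≤ f x * ‖w x - z x‖ ^ 2 := by positivity
    nlinarith

lemma IsGluingStable.exists_norm_apply_le [CompactSpace X] {E : Set C(X, ℂ)}
    (hE : IsGluingStable E) (hcl : IsClosed E) {r : ℝ} (hr : 0 ≤ r)
    (h : ∀ s, r < s → ∃ g ∈ E, ∀ x, ‖g x‖ < s) : ∃ g ∈ E, ∀ x, ‖g x‖ ≤ r := by
  have hsq : ∀ β : ℝ, 0 < β → ∃ g ∈ E, ∀ x, ‖g x‖ ^ 2 ≤ r ^ 2 + β := fun β hβ => by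
    obtain ⟨g, hg, hgs⟩ := h √(r ^ 2 + β) (by rw [Real.lt_sqrt hr]; linarith)
    refine ⟨g, hg, fun x => ?_⟩
    rw [← Real.sq_sqrt (show 0 ≤ r ^ 2 + β by positivity)]
    exact pow_le_pow_left₀ (norm_nonneg _) (hgs x).le 2
  have hiff : ∀ (g : C(X, ℂ)) {β : ℝ}, 0 ≤ β →
      (‖g‖ ^ 2 - r ^ 2 ≤ β ↔ ∀ x, ‖g x‖ ^ 2 ≤ r ^ 2 + β) := fun g β hβ => by
    rw [sub_le_iff_le_add']
    refine ⟨fun h x => (pow_le_pow_left₀ (norm_nonneg _) (g.norm_coe_le_norm x) 2).trans h,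
      fun h => ?_⟩
    have h0 : 0 ≤ r ^ 2 + β := by positivity
    rw [← Real.le_sqrt (norm_nonneg _) h0, ContinuousMap.norm_le _ (Real.sqrt_nonneg _)]
    exact fun x => (Real.le_sqrt (norm_nonneg _) h0).2 (h x)
  suffices key : ∃ g ∈ E, ‖g‖ ^ 2 - r ^ 2 ≤ 0 by
    obtain ⟨g, hg, h1⟩ := key
    exact ⟨g, hg, fun x => (g.norm_coe_le_norm x).trans
      ((sq_le_sq₀ (norm_nonneg _) hr).1 (by linarith))⟩
  refine exists_le_zero_of_forall_step hcl (f := fun g : C(X, ℂ) => ‖g‖ ^ 2 - r ^ 2)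
    (by fun_prop) ?_ fun n z hz hn => ?_
  · obtain ⟨g, hg, h1⟩ := hsq 1 one_pos
    exact ⟨g, hg, (hiff g zero_le_one).2 h1⟩
  · obtain ⟨w, hw, hw'⟩ := hsq ((1 / 4) ^ (n + 1) / 2) (by positivity)
    obtain ⟨z', hz', h1, h2⟩ := exists_glue_norm_sq_le hE hz hw (by positivity) (by positivity)
      ((hiff z (by positivity)).1 hn) hw'
    refine ⟨z', hz', (hiff z' (by positivity)).2 h1, ?_⟩
    rw [ContinuousMap.dist_le (by positivity)]
    intro x
    rw [dist_eq_norm]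
    refine (sq_le_sq₀ (norm_nonneg _) (by positivity)).1 ((h2 x).trans_eq ?_)
    rw [← pow_mul, mul_comm n, pow_mul]
    norm_num

end Selection

section RealSelection

lemma abs_mul_div_sq_add_le (d : ℝ) {ε : ℝ} (hε : 0 < ε) : |d * (ε ^ 2 / (d ^ 2 + ε ^ 2))| ≤ ε := by
  have h : 0 < d ^ 2 + ε ^ 2 := by positivity
  rw [← mul_div_assoc, abs_div, abs_of_pos h, div_le_iff₀ h, abs_mul, abs_of_nonneg (sq_nonneg ε),
    ← sq_abs d]
  nlinarith [sq_nonneg (|d| - ε), abs_nonneg d, mul_nonneg hε.le (sq_nonneg (|d| - ε)),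
    mul_nonneg hε.le (sq_nonneg |d|), pow_pos hε 3]

/-- The point between `z` and `z'` at which `z` arrives when moved towards
`Set.Icc (w - r) (w + r)`. -/
def towards (r z z' w : ℝ) : ℝ :=
  max (min z z') (min (max z z') (max (w - r) (min (w + r) z)))

lemma towards_mem (r z z' w : ℝ) : min z z' ≤ towards r z z' w ∧ towards r z z' w ≤ max z z' :=
  ⟨le_max_left _ _, max_le min_le_max (min_le_left _ _)⟩

lemma abs_towards_sub_le {r z z' w α : ℝ} (hr : 0 ≤ r) (hα : 0 ≤ α) (h : |z - w| ≤ r + α) :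
    |z - towards r z z' w| ≤ α ∧ |towards r z z' w - w| ≤ r + α := by
  rw [abs_le] at *
  unfold towards
  grind

lemma abs_sub_towards_le {r z z' w w' β : ℝ} (hr : 0 ≤ r) (hβ : 0 ≤ β) (h : |z' - w'| ≤ r + β) :
    |towards r z z' w - towards r w w' (towards r z z' w)| ≤ r + β := by
  rw [abs_le] at *
  unfold towards
  grind

variable {X : Type*} [TopologicalSpace X] [CompactSpace X]

lemma IsGluingStable.mem_of_between {E : Set C(X, ℂ)} (hE : IsGluingStable E) (hcl : IsClosed E)
    {g g' k : C(X, ℝ)} (hg : toC g ∈ E) (hg' : toC g' ∈ E) (h : ∀ x, min (g x) (g' x) ≤ k x)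
    (h' : ∀ x, k x ≤ max (g x) (g' x)) : toC k ∈ E := by
  refine hcl.closure_subset (Metric.mem_closure_iff.2 fun ε hε => ?_)
  obtain ⟨δ, hδ, hδε⟩ := exists_between hε
  have hpos : ∀ x, 0 < (g' x - g x) ^ 2 + δ ^ 2 := fun x => by positivity
  let f : C(X, ℝ) := ⟨fun x => (k x - g x) * (g' x - g x) / ((g' x - g x) ^ 2 + δ ^ 2),
    Continuous.div (by fun_prop) (by fun_prop) fun x => (hpos x).ne'⟩
  have hf : ∀ x, f x = (k x - g x) * (g' x - g x) / ((g' x - g x) ^ 2 + δ ^ 2) := fun _ => rfl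
  have hk : ∀ x, 0 ≤ (k x - g x) * (g' x - g x) ∧
      (k x - g x) * (g' x - g x) ≤ (g' x - g x) ^ 2 ∧ |k x - g x| ≤ |g' x - g x| := fun x => by
    have h1 := h x
    have h2 := h' x
    rcases le_total (g x) (g' x) with h3 | h3
    · rw [min_eq_left h3] at h1
      rw [max_eq_right h3] at h2
      refine ⟨by nlinarith, by nlinarith, abs_le_abs_of_nonneg ?_ ?_⟩ <;> linarith
    · rw [min_eq_right h3] at h1
      rw [max_eq_left h3] at h2
      refine ⟨by nlinarith, by nlinarith, abs_le_abs_of_nonpos ?_ ?_⟩ <;> linarith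
  have h0 : ∀ x, 0 ≤ f x := fun x => div_nonneg (hk x).1 (hpos x).le
  have h1 : ∀ x, f x ≤ 1 := fun x => (div_le_one (hpos x)).2 (by nlinarith [(hk x).2.1])
  refine ⟨_, hE _ hg' _ hg f h0 h1,
    lt_of_le_of_lt ((ContinuousMap.dist_le hδ.le).2 fun x => ?_) hδε⟩
  have e : toC k x - (toC f * toC g' + (1 - toC f) * toC g) x =
      (((k x - g x) * (δ ^ 2 / ((g' x - g x) ^ 2 + δ ^ 2)) : ℝ) : ℂ) := by
    have e1 : (k x - g x) * (δ ^ 2 / ((g' x - g x) ^ 2 + δ ^ 2)) =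
        k x - (f x * g' x + (1 - f x) * g x) := by
      rw [hf]
      have := (hpos x).ne'
      field_simp
      ring
    rw [e1]
    simp
  rw [dist_eq_norm, e, Complex.norm_real, Real.norm_eq_abs]
  refine le_trans ?_ (abs_mul_div_sq_add_le (g' x - g x) hδ)
  rw [abs_mul, abs_mul]
  exact mul_le_mul_of_nonneg_right (hk x).2.2 (abs_nonneg _)

lemma IsGluingStable.exists_abs_sub_apply_le {E F : Set C(X, ℂ)} (hE : IsGluingStable E)
    (hF : IsGluingStable F) (hEc : IsClosed E) (hFc : IsClosed F) {r : ℝ} (hr : 0 ≤ r)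
    (h : ∀ s, r < s → ∃ g g' : C(X, ℝ), toC g ∈ E ∧ toC g' ∈ F ∧ ∀ x, |g x - g' x| < s) :
    ∃ g g' : C(X, ℝ), toC g ∈ E ∧ toC g' ∈ F ∧ ∀ x, |g x - g' x| ≤ r := by
  have hcont : Continuous (toC : C(X, ℝ) → C(X, ℂ)) :=
    ContinuousMap.continuous_postcomp ⟨_, Complex.continuous_ofReal⟩
  have hiff : ∀ (g g' : C(X, ℝ)) {β : ℝ}, 0 ≤ β →
      (‖g - g'‖ - r ≤ β ↔ ∀ x, |g x - g' x| ≤ r + β) := fun g g' β hβ => by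
    rw [sub_le_iff_le_add', ContinuousMap.norm_le _ (by positivity)]
    rfl
  suffices key : ∃ p ∈ {p : C(X, ℝ) × C(X, ℝ) | toC p.1 ∈ E ∧ toC p.2 ∈ F}, ‖p.1 - p.2‖ - r ≤ 0 by
    obtain ⟨p, hp, h1⟩ := key
    exact ⟨p.1, p.2, hp.1, hp.2, by simpa using (hiff _ _ le_rfl).1 h1⟩
  refine exists_le_zero_of_forall_step (f := fun p : C(X, ℝ) × C(X, ℝ) => ‖p.1 - p.2‖ - r)
    ((hEc.preimage (hcont.comp continuous_fst)).inter (hFc.preimage (hcont.comp continuous_snd)))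
    (by fun_prop) ?_ ?_
  · obtain ⟨g, g', hg, hg', h1⟩ := h (r + 1) (by linarith)
    exact ⟨(g, g'), ⟨hg, hg'⟩, (hiff _ _ zero_le_one).2 fun x => (h1 x).le⟩
  · rintro n ⟨z, w⟩ ⟨hz, hw⟩ hn
    have hn' := (hiff z w (by positivity)).1 hn
    obtain ⟨g, g', hg, hg', h1⟩ := h (r + (1 / 4) ^ (n + 1)) (lt_add_of_pos_right _ (by positivity))
    let z' : C(X, ℝ) := ⟨fun x => towards r (z x) (g x) (w x), by unfold towards; fun_prop⟩
    let w' : C(X, ℝ) := ⟨fun x => towards r (w x) (g' x) (z' x), by unfold towards; fun_prop⟩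
    have hα : (0 : ℝ) ≤ (1 / 4) ^ n := by positivity
    have hle : ((1 / 4) ^ n : ℝ) ≤ (1 / 2) ^ n := by gcongr; norm_num
    have h2 := fun x => abs_towards_sub_le (z' := g x) hr hα (hn' x)
    have h3 := fun x => abs_towards_sub_le (z' := g' x) hr hα
      ((abs_sub_comm (w x) (z' x)).trans_le (h2 x).2)
    refine ⟨(z', w'), ⟨?_, ?_⟩, ?_, ?_⟩
    · exact hE.mem_of_between hEc hz hg (fun x => (towards_mem _ _ _ _).1)
        fun x => (towards_mem _ _ _ _).2
    · exact hF.mem_of_between hFc hw hg' (fun x => (towards_mem _ _ _ _).1)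
        fun x => (towards_mem _ _ _ _).2
    · exact (hiff z' w' (by positivity)).2 fun x =>
        abs_sub_towards_le hr (by positivity) (h1 x).le
    · refine max_le ((ContinuousMap.dist_le (by positivity)).2 fun x => ?_)
        ((ContinuousMap.dist_le (by positivity)).2 fun x => ?_)
      · exact (h2 x).1.trans hle
      · exact (h3 x).1.trans hle

end RealSelection

section Distance

variable {X : Type*} [TopologicalSpace X] {ι : C(X, ℂ) →⋆ₐ[ℂ] A}

lemma map_mem_dixmierSet {a : A} {g : C(X, ℂ)} (hg : g ∈ centralValues ι a) :
    ι g ∈ dixmierSet a := by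
  rw [dixmierSet_eq_dixSet]
  exact dixSet_mono expMonoid_le_unitary a hg

variable [CompactSpace X] (H : IsDixmierModel ι)
include H

lemma IsDixmierModel.isGluingStable (a : A) : IsGluingStable (centralValues ι a) :=
  fun _ hg _ hg' _ h0 h1 => H.glue hg hg' h0 h1

lemma IsDixmierModel.setDist_le_norm_sub {a b : A} {g h : C(X, ℂ)}
    (hg : g ∈ centralValues ι a) (hh : h ∈ centralValues ι b) :
    setDist (dixmierSet a) (dixmierSet b) ≤ ‖g - h‖ := by
  rw [← H.norm_map, map_sub, ← dist_eq_norm]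
  exact setDist_le (map_mem_dixmierSet hg) (map_mem_dixmierSet hh)

lemma IsDixmierModel.exists_centralValues_norm_sub_apply_lt [PartialOrder A] [StarOrderedRing A]
    (a b : A) {s : ℝ}
    (hs : sSup {d : ℝ | ∃ M : Submodule ℂ A, IsMaximalClosedIdeal M ∧
        d = setDist (dixmierF M a) (dixmierF M b)} < s) :
    ∃ g ∈ centralValues ι a, ∃ h ∈ centralValues ι b, ∀ x, ‖g x - h x‖ < s :=
  IsGluingStable.exists_norm_sub_apply_lt (H.isGluingStable a) (H.isGluingStable b)
    (H.nonempty a) (H.nonempty b) fun x => H.exists_apply_sub_lt x a b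
      ((setDist_dixmierF_le_sSup (H.isMaximalClosedIdeal x) a b).trans_lt hs)

lemma IsDixmierModel.exists_toC_eq {a : A} (ha : IsSelfAdjoint a) {g : C(X, ℂ)}
    (hg : g ∈ centralValues ι a) : ∃ f : C(X, ℝ), toC f = g := by
  refine ⟨⟨fun x => (g x).re, by fun_prop⟩, ContinuousMap.ext fun x => ?_⟩
  exact Complex.conj_eq_iff_re.1 (DFunLike.congr_fun (H.star_eq ha hg) x)

end Distance

/-- **Proposition 5.9.**  In a unital C*-algebra with the Dixmier property, the distance
between `D_A(a)` and `D_A(b)` equals `r = sup_M d(F_a(M), F_b(M))`, the supremum being over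
maximal closed two-sided ideals.  If `a, b` are both self-adjoint, or if `b = 0`, the
distance is attained by central elements of the Dixmier sets. -/
theorem dixmierSet_distance_of_dixmierProperty (A : Type*) [CStarAlgebra A]
    (hDP : DixmierProperty A) (a b : A) :
    setDist (dixmierSet a) (dixmierSet b) =
      sSup {d : ℝ | ∃ M : Submodule ℂ A, IsMaximalClosedIdeal M ∧
        d = setDist (dixmierF M a) (dixmierF M b)} ∧
    ((IsSelfAdjoint a ∧ IsSelfAdjoint b) ∨ b = 0 →
      ∃ za ∈ dixmierSet a ∩ Set.center A, ∃ zb ∈ dixmierSet b ∩ Set.center A,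
        ‖za - zb‖ = setDist (dixmierSet a) (dixmierSet b)) := by
  let _ := CStarAlgebra.spectralOrder A
  have _ := CStarAlgebra.spectralOrderedRing A
  obtain ⟨X, _, _, ι, hι, hrange⟩ := exists_center_model A
  have H : IsDixmierModel ι := ⟨hι, hrange, hDP⟩
  have hnear := fun s => H.exists_centralValues_norm_sub_apply_lt a b (s := s)
  have hle := sSup_dixmierF_le a b
  have hr : 0 ≤ sSup {d : ℝ | ∃ M : Submodule ℂ A, IsMaximalClosedIdeal M ∧
      d = setDist (dixmierF M a) (dixmierF M b)} := by
    refine Real.sSup_nonneg ?_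
    rintro _ ⟨M, -, rfl⟩
    exact setDist_nonneg _ _
  set r := sSup {d : ℝ | ∃ M : Submodule ℂ A, IsMaximalClosedIdeal M ∧
      d = setDist (dixmierF M a) (dixmierF M b)}
  have heq : setDist (dixmierSet a) (dixmierSet b) = r := by
    refine le_antisymm (le_of_forall_gt_imp_ge_of_dense fun s hs => ?_) hle
    obtain ⟨g, hg, h, hh, hlt⟩ := hnear s hs
    exact (H.setDist_le_norm_sub hg hh).trans
      ((ContinuousMap.norm_le _ (hr.trans hs.le)).2 fun x => (hlt x).le)
  refine ⟨heq, fun hab => ?_⟩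
  suffices h : ∃ g ∈ centralValues ι a, ∃ h ∈ centralValues ι b, ∀ x, ‖g x - h x‖ ≤ r by
    obtain ⟨g, hg, h, hh, hgh⟩ := h
    refine ⟨ι g, ⟨map_mem_dixmierSet hg, H.map_mem_center g⟩,
      ι h, ⟨map_mem_dixmierSet hh, H.map_mem_center h⟩, ?_⟩
    rw [← map_sub, H.norm_map]
    refine le_antisymm ?_ (H.setDist_le_norm_sub hg hh)
    exact heq ▸ (ContinuousMap.norm_le _ hr).2 hgh
  rcases hab with ⟨ha, hb⟩ | rfl
  · obtain ⟨g, g', hg, hg', h⟩ := IsGluingStable.exists_abs_sub_apply_le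
      (H.isGluingStable a) (H.isGluingStable b) (H.isClosed a) (H.isClosed b) hr fun s hs => by
        obtain ⟨g, hg, h, hh, hlt⟩ := hnear s hs
        obtain ⟨f, rfl⟩ := H.exists_toC_eq ha hg
        obtain ⟨f', rfl⟩ := H.exists_toC_eq hb hh
        refine ⟨f, f', hg, hh, fun x => ?_⟩
        simpa [← Complex.ofReal_sub] using hlt x
    refine ⟨_, hg, _, hg', fun x => ?_⟩
    simpa [← Complex.ofReal_sub] using h x
  · have h0 : (0 : C(X, ℂ)) ∈ centralValues ι (0 : A) := by
      simpa using self_mem_centralValues (ι := ι) 0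
    obtain ⟨g, hg, hle⟩ := IsGluingStable.exists_norm_apply_le (H.isGluingStable a)
      (H.isClosed a) hr fun s hs => by
        obtain ⟨g, hg, h, hh, hlt⟩ := hnear s hs
        obtain rfl : h = 0 := H.eq_of_mem (by simpa using hh)
        exact ⟨g, hg, by simpa using hlt⟩
    exact ⟨g, hg, 0, h0, by simpa using hle⟩

end
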